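/- arXiv:2509.22749 — 5 statements merged into one kernel-verified Lean document; each statement's English description precedes it below -/
import Mathlib

section
/- For every n ≥ 6, the commutator map (τ, π) ↦ τ⁻¹π⁻¹τπ from pairs of n-cycles in the symmetric group Sₙ to the alternating group Aₙ is surjective; that is, every even permutation on n symbols is a commutator of two n-cycles. -/
open Equiv

/-- `τ` acts on `α` as a single cycle. -/
def Equiv.Perm.IsFull {α : Type*} (τ : Perm α) : Prop := ∀ x y, τ.SameCycle x y

/-- Two full cycles `τ` and `π` on `α` which agree at the point `base`, together with a labelling
of the orbits of their commutator by `ι`, such that every orbit with at least five elements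
contains a point `loop` and its common image under `τ` and `π`. -/
structure CyclePair (α ι : Type) [Fintype α] [DecidableEq ι] where
  τ : Perm α
  π : Perm α
  base : α
  label : α → ι
  loop : ι → α
  full_τ : τ.IsFull
  full_π : π.IsFull
  apply_base : τ base = π base
  sameCycle_iff : ∀ x y, (τ⁻¹ * π⁻¹ * τ * π).SameCycle x y ↔ label x = label y
  apply_loop : ∀ i, 5 ≤ Fintype.card {x // label x = i} →
    τ (loop i) = π (loop i) ∧ label (loop i) = i ∧ label (τ (loop i)) = i ∧
      τ (loop i) ≠ base ∧ τ (loop i) ≠ loop i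

/-- The multiset `m` is the orbit type of the commutator in some `CyclePair`. -/
def Realizable (m : Multiset ℕ) : Prop :=
  ∃ (α ι : Type) (_ : Fintype α) (_ : Fintype ι) (_ : DecidableEq ι) (P : CyclePair α ι),
    Finset.univ.val.map (fun i => Fintype.card {x // P.label x = i}) = m

theorem isFull_finRotate (n : ℕ) : (finRotate (n + 1)).IsFull := by
  have h : ∀ x : Fin (n + 1), (finRotate (n + 1)).SameCycle 0 x := by
    intro x
    refine Fin.induction (Perm.SameCycle.refl _ _) (fun i hi => ?_) x
    rw [← Fin.coeSucc_eq_succ, ← finRotate_apply]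
    exact hi.trans (Perm.sameCycle_apply_right.2 (Perm.SameCycle.refl _ _))
  exact fun x y => (h x).symm.trans (h y)

theorem Equiv.Perm.IsFull.conj {α : Type*} {τ : Perm α} (h : τ.IsFull) (g : Perm α) :
    (g * τ * g⁻¹).IsFull := fun _ _ => Perm.sameCycle_conj.2 (h _ _)

/-- A combinatorial criterion for realizability: `τ` is the rotation of `Fin (n + 1)`, `π` is its
conjugate by the permutation `w` with inverse `v`, and `r` picks a representative of each orbit. -/
theorem realizable_of_word {n k : ℕ} {m : Multiset ℕ} (w v : Fin (n + 1) → Fin (n + 1))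
    (f : Fin (n + 1) → Fin k) (r d : Fin k → Fin (n + 1)) (hvw : ∀ x, v (w x) = x ∧ w (v x) = x)
    (hb : w (v (Fin.last n) + 1) = Fin.last n + 1)
    (hf : ∀ x, f (w (v (w (v x + 1) + 1) - 1) - 1) = f x)
    (hr : ∀ x, ∃ j : Fin (n + 1), (fun x => w (v (w (v x + 1) + 1) - 1) - 1)^[j] (r (f x)) = x)
    (hd : ∀ i, 5 ≤ Fintype.card {x // f x = i} →
      d i + 1 = w (v (d i) + 1) ∧ f (d i) = i ∧ f (d i + 1) = i ∧ d i + 1 ≠ Fin.last n ∧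
        d i + 1 ≠ d i)
    (hm : Finset.univ.val.map (fun i => Fintype.card {x // f x = i}) = m) : Realizable m := by
  let g : Perm (Fin (n + 1)) := ⟨w, v, fun x => (hvw x).1, fun x => (hvw x).2⟩
  let τ := finRotate (n + 1)
  let π := g * τ * g⁻¹
  have hτ : ∀ x, τ x = x + 1 := finRotate_apply
  have hτ' : ∀ x, τ⁻¹ x = x - 1 := fun x => by rw [Perm.inv_eq_iff_eq, hτ, sub_add_cancel]
  have hπ : ∀ x, π x = w (v x + 1) := fun x => congrArg w (hτ (v x))
  have hπ' : ∀ x, π⁻¹ x = w (v x - 1) := fun x => by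
    rw [Perm.inv_eq_iff_eq, hπ, (hvw _).1, sub_add_cancel, (hvw _).2]
  have hσ : ∀ x, (τ⁻¹ * π⁻¹ * τ * π) x = w (v (w (v x + 1) + 1) - 1) - 1 := fun x => by
    simp only [Perm.mul_apply, hτ, hτ', hπ, hπ']
  have hlab : ∀ x y, (τ⁻¹ * π⁻¹ * τ * π).SameCycle x y → f x = f y := by
    intro x y h
    obtain ⟨i, -, rfl⟩ := h.exists_pow_eq'
    induction i with
    | zero => rfl
    | succ i ih => rw [pow_succ', Perm.mul_apply, hσ, hf, ih ⟨i, by simp⟩]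
  have hrep : ∀ x, (τ⁻¹ * π⁻¹ * τ * π).SameCycle (r (f x)) x := by
    intro x
    obtain ⟨j, hj⟩ := hr x
    refine ⟨(j : ℕ), ?_⟩
    rw [zpow_natCast, ← Perm.iterate_eq_pow]
    exact (congrFun (congrArg (fun s => s^[(j : ℕ)]) (funext hσ)) _).trans hj
  refine ⟨Fin (n + 1), Fin k, inferInstance, inferInstance, inferInstance,
    ⟨τ, π, Fin.last n, f, d, isFull_finRotate n, (isFull_finRotate n).conj g, ?_, ?_, ?_⟩, hm⟩
  · rw [hτ, hπ, hb]
  · exact fun x y => ⟨hlab x y, fun h => (hrep x).symm.trans (h ▸ hrep y)⟩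
  · simpa only [hτ, hπ] using hd

theorem Equiv.Perm.SameCycle.comp_eq {α ι : Type*} {σ : Perm α} {f : α → ι}
    (hf : ∀ x, f (σ x) = f x) {x y : α} (h : σ.SameCycle x y) : f x = f y := by
  obtain ⟨i, rfl⟩ := h
  induction i with
  | zero => rfl
  | succ i ih => rw [add_comm, zpow_add, Perm.mul_apply, zpow_one, hf, ih]
  | pred i ih =>
    rw [ih, ← hf ((σ ^ (-(i : ℤ) - 1)) x), ← Perm.mul_apply, ← zpow_one_add]
    congr 3
    ring

theorem Equiv.Perm.SameCycle.map {α β : Type*} {σ : Perm α} {ρ : Perm β} {g : α → β}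
    (hg : ∀ x, ρ.SameCycle (g x) (g (σ x))) {x y : α} (h : σ.SameCycle x y) :
    ρ.SameCycle (g x) (g y) := by
  let : Setoid β := Perm.SameCycle.setoid ρ
  exact Quotient.exact (Perm.SameCycle.comp_eq (f := fun x => (⟦g x⟧ : Quotient _))
    (fun x => (Quotient.sound (hg x)).symm) h)

theorem Equiv.Perm.IsFull.mem_of_closed {α : Type*} [Finite α] {τ : Perm α} (h : τ.IsFull)
    {p : α → Prop} (hp : ∀ x, p x → p (τ x)) {x : α} (hx : p x) (y : α) : p y := by
  obtain ⟨i, -, rfl⟩ := (h x y).exists_pow_eq'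
  clear * - hp hx
  induction i with
  | zero => exact hx
  | succ i ih => rw [pow_succ', Perm.mul_apply]; exact hp _ ih

theorem Equiv.Perm.isFull_of_closed {α : Type*} {τ : Perm α}
    (h : ∀ p : α → Prop, (∀ x, p x → p (τ x)) → ∀ x y, p x → p y) : τ.IsFull :=
  fun x y => h (τ.SameCycle x) (fun _ hz => Perm.sameCycle_apply_right.2 hz) x y
    (Perm.SameCycle.refl _ _)

theorem Equiv.Perm.IsFull.sumCongr_mul_swap {α β : Type*} [Finite α] [Finite β] [DecidableEq α]
    [DecidableEq β] {τ : Perm α} {τ' : Perm β} (h : τ.IsFull) (h' : τ'.IsFull) (a : α) (b : β) :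
    (Perm.sumCongr τ τ' * swap (Sum.inl a) (Sum.inr b)).IsFull := by
  refine Perm.isFull_of_closed fun p hp => ?_
  have ha : p (Sum.inl a) → p (Sum.inr (τ' b)) := fun h => by simpa using hp _ h
  have hb : p (Sum.inr b) → p (Sum.inl (τ a)) := fun h => by simpa using hp _ h
  have hl : ∀ x, x ≠ a → p (Sum.inl x) → p (Sum.inl (τ x)) := fun x hx h => by
    simpa [swap_apply_def, hx] using hp _ h
  have hr : ∀ x, x ≠ b → p (Sum.inr x) → p (Sum.inr (τ' x)) := fun x hx h => by
    simpa [swap_apply_def, hx] using hp _ h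
  have key_l : ∀ x, p (Sum.inl x) → p (Sum.inl a) := fun x hx => by
    by_contra hn
    exact hn (h.mem_of_closed (p := fun x => p (Sum.inl x))
      (fun x hx => hl x (fun e => hn (e ▸ hx)) hx) hx a)
  have key_r : ∀ x, p (Sum.inr x) → p (Sum.inr b) := fun x hx => by
    by_contra hn
    exact hn (h'.mem_of_closed (p := fun x => p (Sum.inr x))
      (fun x hx => hr x (fun e => hn (e ▸ hx)) hx) hx b)
  have main : p (Sum.inl a) → p (Sum.inr b) → ∀ y, p y := by
    intro h₁ h₂ y
    rcases y with y | y
    · refine h.mem_of_closed (p := fun x => p (Sum.inl x)) (fun x hx => ?_) h₁ y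
      by_cases e : x = a
      · exact e ▸ hb h₂
      · exact hl x e hx
    · refine h'.mem_of_closed (p := fun x => p (Sum.inr x)) (fun x hx => ?_) h₂ y
      by_cases e : x = b
      · exact e ▸ ha h₁
      · exact hr x e hx
  rintro (x | x) y hx
  · exact main (key_l x hx) (key_r _ (ha (key_l x hx))) y
  · exact main (key_l _ (hb (key_r x hx))) (key_r x hx) y

theorem Equiv.Perm.sameCycle_sumCongr_iff {α β ι κ : Type*} {σ : Perm α} {ρ : Perm β} {f : α → ι}
    {g : β → κ} (hf : ∀ x y, σ.SameCycle x y ↔ f x = f y)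
    (hg : ∀ x y, ρ.SameCycle x y ↔ g x = g y) (x y : α ⊕ β) :
    (Perm.sumCongr σ ρ).SameCycle x y ↔ Sum.map f g x = Sum.map f g y := by
  constructor
  · refine Perm.SameCycle.comp_eq fun z => ?_
    rcases z with z | z
    · simpa using ((hf z (σ z)).1 (Perm.sameCycle_apply_right.2 (Perm.SameCycle.refl _ _))).symm
    · simpa using ((hg z (ρ z)).1 (Perm.sameCycle_apply_right.2 (Perm.SameCycle.refl _ _))).symm
  · rcases x with x | x <;> rcases y with y | y
    · intro h
      refine Perm.SameCycle.map (σ := σ) (g := Sum.inl) (fun x => ?_)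
        ((hf x y).2 (by simpa using h))
      exact Perm.sameCycle_apply_right.2 (Perm.SameCycle.refl (Perm.sumCongr σ ρ) (Sum.inl x))
    · simp
    · simp
    · intro h
      refine Perm.SameCycle.map (σ := ρ) (g := Sum.inr) (fun x => ?_)
        ((hg x y).2 (by simpa using h))
      exact Perm.sameCycle_apply_right.2 (Perm.SameCycle.refl (Perm.sumCongr σ ρ) (Sum.inr x))

theorem Realizable.add {m m' : Multiset ℕ} (h : Realizable m) (h' : Realizable m') :
    Realizable (m + m') := by
  classical
  obtain ⟨α, ι, _, _, _, P, rfl⟩ := h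
  obtain ⟨β, κ, _, _, _, Q, rfl⟩ := h'
  let s : Perm (α ⊕ β) := swap (Sum.inl P.base) (Sum.inr Q.base)
  let T : Perm (α ⊕ β) := Perm.sumCongr P.τ Q.τ
  let S : Perm (α ⊕ β) := Perm.sumCongr P.π Q.π
  let F : α ⊕ β → ι ⊕ κ := fun x => Sum.map P.label Q.label (s x)
  have hss : s * s = 1 := swap_mul_self _ _
  have hs : s⁻¹ = s := swap_inv _ _
  have hcomm : S⁻¹ * T * s = s * (S⁻¹ * T) := by
    have := swap_apply_apply (S⁻¹ * T) (Sum.inl P.base) (Sum.inr Q.base)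
    have e₁ : (S⁻¹ * T) (Sum.inl P.base) = Sum.inl P.base := by
      rw [Perm.mul_apply, Perm.inv_eq_iff_eq]
      simp [T, S, P.apply_base]
    have e₂ : (S⁻¹ * T) (Sum.inr Q.base) = Sum.inr Q.base := by
      rw [Perm.mul_apply, Perm.inv_eq_iff_eq]
      simp [T, S, Q.apply_base]
    rw [e₁, e₂] at this
    exact (eq_mul_inv_iff_mul_eq.1 this).symm
  have hσ : (T * s)⁻¹ * (S * s)⁻¹ * (T * s) * (S * s) =
      s * Perm.sumCongr (P.τ⁻¹ * P.π⁻¹ * P.τ * P.π) (Q.τ⁻¹ * Q.π⁻¹ * Q.τ * Q.π) * s⁻¹ := by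
    have e : Perm.sumCongr (P.τ⁻¹ * P.π⁻¹ * P.τ * P.π) (Q.τ⁻¹ * Q.π⁻¹ * Q.τ * Q.π) =
        T⁻¹ * S⁻¹ * T * S := by
      simp only [T, S, Perm.sumCongr_inv, Perm.sumCongr_mul]
    rw [e]
    calc (T * s)⁻¹ * (S * s)⁻¹ * (T * s) * (S * s)
        = s⁻¹ * T⁻¹ * s⁻¹ * (S⁻¹ * T * s) * S * s := by group
      _ = s * T⁻¹ * (s * s) * (S⁻¹ * T) * S * s := by rw [hcomm, hs]; group
      _ = s * (T⁻¹ * S⁻¹ * T * S) * s⁻¹ := by rw [hss, hs]; group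
  have hcard : ∀ j, Fintype.card {x // F x = j} =
      Sum.elim (fun i => Fintype.card {x // P.label x = i})
        (fun i => Fintype.card {x // Q.label x = i}) j := by
    intro j
    rw [Fintype.card_congr (Equiv.subtypeEquiv (q := fun x => Sum.map P.label Q.label x = j) s
      (fun _ => Iff.rfl)), Fintype.card_congr Equiv.subtypeSum, Fintype.card_sum]
    rcases j with j | j <;> simp
  have hloop_l : ∀ i, P.τ (P.loop i) ≠ P.base →
      s (Sum.inl (P.τ (P.loop i))) = Sum.inl (P.τ (P.loop i)) := fun i hi =>
    swap_apply_of_ne_of_ne (by simpa using hi) (by simp)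
  have hloop_r : ∀ i, Q.τ (Q.loop i) ≠ Q.base →
      s (Sum.inr (Q.τ (Q.loop i))) = Sum.inr (Q.τ (Q.loop i)) := fun i hi =>
    swap_apply_of_ne_of_ne (by simp) (by simpa using hi)
  have hsT : ∀ x, (T * s) (s x) = T x := fun x => by
    rw [← Perm.mul_apply, mul_assoc, hss, mul_one]
  have hsS : ∀ x, (S * s) (s x) = S x := fun x => by
    rw [← Perm.mul_apply, mul_assoc, hss, mul_one]
  have hs2 : ∀ x, s (s x) = x := fun x => by rw [← Perm.mul_apply, hss, Perm.one_apply]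
  refine ⟨α ⊕ β, ι ⊕ κ, inferInstance, inferInstance, inferInstance,
    ⟨T * s, S * s, Sum.inl P.base, F,
      Sum.elim (fun i => s (Sum.inl (P.loop i))) (fun i => s (Sum.inr (Q.loop i))),
      P.full_τ.sumCongr_mul_swap Q.full_τ _ _, P.full_π.sumCongr_mul_swap Q.full_π _ _,
      ?_, ?_, ?_⟩, ?_⟩
  · simp [T, S, s, Q.apply_base]
  · intro x y
    rw [hσ, Perm.sameCycle_conj, Perm.sameCycle_sumCongr_iff P.sameCycle_iff Q.sameCycle_iff, hs]
  · rintro (i | i) hi <;> rw [hcard] at hi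
    · obtain ⟨h₁, h₂, h₃, h₄, h₅⟩ := P.apply_loop i hi
      simp only [Sum.elim_inl, hsT, hsS, F, hs2]
      refine ⟨by simp [T, S, h₁], by simp [h₂], ?_, by simpa [T] using h₄, ?_⟩
      · simp only [T, Perm.sumCongr_apply, Sum.map_inl, hloop_l i h₄, h₃]
      · simp only [T, Perm.sumCongr_apply, Sum.map_inl]
        rw [← hloop_l i h₄]
        simpa using h₅
    · obtain ⟨h₁, h₂, h₃, h₄, h₅⟩ := Q.apply_loop i hi
      simp only [Sum.elim_inr, hsT, hsS, F, hs2]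
      refine ⟨by simp [T, S, h₁], by simp [h₂], ?_, by simp [T], ?_⟩
      · simp only [T, Perm.sumCongr_apply, Sum.map_inr, hloop_r i h₄, h₃]
      · simp only [T, Perm.sumCongr_apply, Sum.map_inr]
        rw [← hloop_r i h₄]
        simpa using h₅
  · rw [← Finset.univ_disjSum_univ, Finset.val_disjSum, Multiset.disjSum, Multiset.map_add,
      Multiset.map_map, Multiset.map_map]
    congr 1 <;> refine Multiset.map_congr rfl fun i _ => ?_
    · exact hcard (Sum.inl i)
    · exact hcard (Sum.inr i)

theorem Equiv.Perm.isFull_of_insert {α : Type*} [Finite α] {τ : Perm α} (h : τ.IsFull) (e : α)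
    {ρ : Perm (α ⊕ Bool)} {b : Bool} (hρ : ∀ x, x ≠ e → ρ (Sum.inl x) = Sum.inl (τ x))
    (h₁ : ρ (Sum.inl e) = Sum.inr b) (h₂ : ρ (Sum.inr b) = Sum.inr !b)
    (h₃ : ρ (Sum.inr !b) = Sum.inl (τ e)) : ρ.IsFull := by
  refine Perm.isFull_of_closed fun p hp => ?_
  have k₁ : p (Sum.inl e) → p (Sum.inr b) := fun h => h₁ ▸ hp _ h
  have k₂ : p (Sum.inr b) → p (Sum.inr !b) := fun h => h₂ ▸ hp _ h
  have k₃ : p (Sum.inr !b) → p (Sum.inl (τ e)) := fun h => h₃ ▸ hp _ h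
  have k : ∀ x, x ≠ e → p (Sum.inl x) → p (Sum.inl (τ x)) := fun x hx h => hρ x hx ▸ hp _ h
  have key : ∀ x, p (Sum.inl x) → p (Sum.inl e) := fun x hx => by
    by_contra hn
    exact hn (h.mem_of_closed (p := fun x => p (Sum.inl x))
      (fun x hx => k x (fun e => hn (e ▸ hx)) hx) hx e)
  have main : p (Sum.inl e) → ∀ y, p y := by
    intro h₀
    have hb := k₁ h₀
    have hl : ∀ y, p (Sum.inl y) := fun y => by
      refine h.mem_of_closed (p := fun x => p (Sum.inl x)) (fun x hx => ?_) h₀ y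
      by_cases hxe : x = e
      · exact hxe ▸ k₃ (k₂ hb)
      · exact k x hxe hx
    rintro (y | y)
    · exact hl y
    · rcases Bool.eq_or_eq_not y b with rfl | rfl
      · exact hb
      · exact k₂ hb
  rintro (x | x) y hx
  · exact main (key x hx) y
  · rcases Bool.eq_or_eq_not x b with rfl | rfl
    · exact main (key _ (k₃ (k₂ hx))) y
    · exact main (key _ (k₃ hx)) y

/-- The cycle `inl e → inr false → inr true → inl e`. -/
def insertCycle {α : Type*} [DecidableEq α] (e : α) : Perm (α ⊕ Bool) :=
  swap (Sum.inl e) (Sum.inr true) * swap (Sum.inl e) (Sum.inr false)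

section insertCycle

variable {α : Type*} [DecidableEq α] (e : α)

@[simp] theorem insertCycle_inl_self : insertCycle e (Sum.inl e) = Sum.inr false := by
  simp [insertCycle, swap_apply_def]

@[simp] theorem insertCycle_false : insertCycle e (Sum.inr false) = Sum.inr true := by
  simp [insertCycle]

@[simp] theorem insertCycle_true : insertCycle e (Sum.inr true) = Sum.inl e := by
  simp [insertCycle, swap_apply_def]

theorem insertCycle_inl {x : α} (h : x ≠ e) : insertCycle e (Sum.inl x) = Sum.inl x := by
  simp [insertCycle, swap_apply_def, h]

@[simp] theorem insertCycle_symm_inl_self : (insertCycle e).symm (Sum.inl e) = Sum.inr true := by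
  simp [symm_apply_eq]

@[simp] theorem insertCycle_symm_false : (insertCycle e).symm (Sum.inr false) = Sum.inl e := by
  simp [symm_apply_eq]

@[simp] theorem insertCycle_symm_true : (insertCycle e).symm (Sum.inr true) = Sum.inr false := by
  simp [symm_apply_eq]

theorem insertCycle_symm_inl {x : α} (h : x ≠ e) :
    (insertCycle e).symm (Sum.inl x) = Sum.inl x := by
  simp [symm_apply_eq, insertCycle_inl e h]

theorem conj_insertCycle (τ : Perm α) :
    (Perm.sumCongr τ (1 : Perm Bool))⁻¹ * insertCycle (τ e) * Perm.sumCongr τ 1 =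
      insertCycle e := by
  rw [mul_assoc, inv_mul_eq_iff_eq_mul]
  ext1 x
  rcases x with x | x
  · by_cases h : x = e
    · simp [h]
    · simp [insertCycle_inl _ h, insertCycle_inl (τ e) (x := τ x) (by simpa using h)]
  · cases x <;> simp

end insertCycle

theorem Realizable.add_two {k : ℕ} {m : Multiset ℕ} (h : Realizable (k ::ₘ m)) (hk : 5 ≤ k) :
    Realizable ((k + 2) ::ₘ m) := by
  classical
  obtain ⟨α, ι, _, _, _, P, hP⟩ := h
  obtain ⟨i, -, rfl⟩ := Multiset.mem_map.1 (hP ▸ Multiset.mem_cons_self k m)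
  obtain ⟨hd₁, hd₂, hd₃, hd₄, hd₅⟩ := P.apply_loop i hk
  set d := P.loop i with hd
  set e := P.τ d with he
  let F : α ⊕ Bool → ι := Sum.elim P.label fun _ => i
  let T : Perm (α ⊕ Bool) := Perm.sumCongr P.τ 1
  let S : Perm (α ⊕ Bool) := Perm.sumCongr P.π 1
  let A := insertCycle e
  let B := insertCycle d
  let g := A⁻¹ * B
  have hB : T⁻¹ * A * T = B := conj_insertCycle d P.τ
  have hB' : S⁻¹ * A * S = B := by
    have := conj_insertCycle d P.π
    rwa [← hd₁] at this
  have hσ : (T * A)⁻¹ * (S * A⁻¹)⁻¹ * (T * A) * (S * A⁻¹) =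
      g * (Perm.sumCongr (P.τ⁻¹ * P.π⁻¹ * P.τ * P.π) 1 * (B * A⁻¹ * A⁻¹ * B)) * g⁻¹ := by
    have h₁ : Perm.sumCongr (P.τ⁻¹ * P.π⁻¹ * P.τ * P.π) (1 : Perm Bool) =
        T⁻¹ * S⁻¹ * T * S := by
      simp only [T, S, Perm.sumCongr_inv, Perm.sumCongr_mul, inv_one, mul_one]
    rw [h₁]
    calc (T * A)⁻¹ * (S * A⁻¹)⁻¹ * (T * A) * (S * A⁻¹)
        = A⁻¹ * (T⁻¹ * A * T) * (T⁻¹ * S⁻¹ * T * S) * (S⁻¹ * A * S) * A⁻¹ := by group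
      _ = A⁻¹ * B * (T⁻¹ * S⁻¹ * T * S) * B * A⁻¹ := by rw [hB, hB']
      _ = _ := by simp only [g]; group
  have hFA : ∀ x, F (A x) = F x := by
    rintro (x | x)
    · by_cases h : x = e
      · subst h; simp [A, F, hd₃]
      · simp [A, F, insertCycle_inl e h]
    · cases x <;> simp [A, F, hd₃]
  have hFB : ∀ x, F (B x) = F x := by
    rintro (x | x)
    · by_cases h : x = d
      · rw [h]; simp [B, F, hd₂]
      · simp [B, F, insertCycle_inl d h]
    · cases x <;> simp [B, F, hd₂]
  have hFA' : ∀ x, F (A⁻¹ x) = F x := fun x => by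
    rw [← hFA, ← Perm.mul_apply, mul_inv_cancel, Perm.one_apply]
  have hFB' : ∀ x, F (B⁻¹ x) = F x := fun x => by
    rw [← hFB, ← Perm.mul_apply, mul_inv_cancel, Perm.one_apply]
  have hFg : ∀ x, F (g⁻¹ x) = F x := fun x => by
    simp only [g, mul_inv_rev, inv_inv, Perm.mul_apply, hFB', hFA]
  set σ := P.τ⁻¹ * P.π⁻¹ * P.τ * P.π with hσ'
  set C := B * A⁻¹ * A⁻¹ * B with hC
  have hCe : C (Sum.inl e) = Sum.inr true := by
    simp [hC, A, B, insertCycle_inl d hd₅]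
  have hCd : C (Sum.inl d) = Sum.inl d := by
    simp [hC, A, B]
  have hCp : C (Sum.inr false) = Sum.inl e := by
    simp [hC, A, B, insertCycle_inl d hd₅]
  have hCq : C (Sum.inr true) = Sum.inr false := by
    simp [hC, A, B, insertCycle_symm_inl e hd₅.symm]
  have hCx : ∀ x, x ≠ e → C (Sum.inl x) = Sum.inl x := fun x hx => by
    by_cases h : x = d
    · rw [h, hCd]
    · simp [hC, A, B, insertCycle_inl d h, insertCycle_symm_inl e hx]
  set R := Perm.sumCongr σ (1 : Perm Bool) * C with hR
  have hRe : R (Sum.inl e) = Sum.inr true := by simp [hR, hCe]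
  have hRp : R (Sum.inr false) = Sum.inl (σ e) := by simp [hR, hCp]
  have hRq : R (Sum.inr true) = Sum.inr false := by simp [hR, hCq]
  have hRx : ∀ x, x ≠ e → R (Sum.inl x) = Sum.inl (σ x) := fun x hx => by simp [hR, hCx x hx]
  have step : ∀ x, R.SameCycle x (R x) := fun x =>
    Perm.sameCycle_apply_right.2 (Perm.SameCycle.refl _ _)
  have hlab : ∀ x, P.label (σ x) = P.label x := fun x =>
    ((P.sameCycle_iff x (σ x)).1 (Perm.sameCycle_apply_right.2 (Perm.SameCycle.refl _ _))).symm
  have heq : R.SameCycle (Sum.inl e) (Sum.inr true) := hRe ▸ step _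
  have hep : R.SameCycle (Sum.inl e) (Sum.inr false) :=
    heq.trans (hRq ▸ step (Sum.inr true))
  have hinl : ∀ x y, P.label x = P.label y → R.SameCycle (Sum.inl x) (Sum.inl y) := by
    intro x y hxy
    refine Perm.SameCycle.map (σ := σ) (g := Sum.inl) (fun x => ?_) ((P.sameCycle_iff x y).2 hxy)
    by_cases hx : x = e
    · rw [hx]; exact hep.trans (hRp ▸ step _)
    · exact hRx x hx ▸ step _
  have hrep : ∀ x, ∃ y, R.SameCycle x (Sum.inl y) ∧ F x = P.label y := by
    rintro (x | (_ | _))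
    · exact ⟨x, Perm.SameCycle.refl _ _, rfl⟩
    · exact ⟨e, hep.symm, hd₃.symm⟩
    · exact ⟨e, heq.symm, hd₃.symm⟩
  have hRF : ∀ x y, R.SameCycle x y ↔ F x = F y := by
    intro x y
    constructor
    · refine Perm.SameCycle.comp_eq ?_
      rintro (x | (_ | _))
      · by_cases hx : x = e
        · rw [hx, hRe]; exact hd₃.symm
        · rw [hRx x hx]; exact hlab x
      · rw [hRp]; exact (hlab e).trans hd₃
      · rw [hRq]; rfl
    · intro h
      obtain ⟨x', hx, hx'⟩ := hrep x
      obtain ⟨y', hy, hy'⟩ := hrep y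
      exact hx.trans ((hinl x' y' (by rw [← hx', ← hy', h])).trans hy.symm)
  have hTA : ∀ x, x ≠ e → (T * A) (Sum.inl x) = Sum.inl (P.τ x) := fun x hx => by
    simp [T, A, insertCycle_inl e hx]
  have hSA : ∀ x, x ≠ e → (S * A⁻¹) (Sum.inl x) = Sum.inl (P.π x) := fun x hx => by
    simp [S, A, insertCycle_symm_inl e hx]
  have hcard : ∀ j, Fintype.card {x // F x = j} =
      Fintype.card {x // P.label x = j} + if j = i then 2 else 0 := by
    intro j
    rw [Fintype.card_congr Equiv.subtypeSum, Fintype.card_sum]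
    congr 1
    by_cases hj : j = i
    · simp [F, hj]
    · simp [F, hj, Ne.symm hj]
  refine ⟨α ⊕ Bool, ι, inferInstance, inferInstance, inferInstance,
    ⟨T * A, S * A⁻¹, Sum.inl P.base, F, fun j => Sum.inl (P.loop j), ?_, ?_, ?_, ?_, ?_⟩, ?_⟩
  · exact Perm.isFull_of_insert P.full_τ e (b := false) hTA (by simp [T, A]) (by simp [T, A])
      (by simp [T, A])
  · exact Perm.isFull_of_insert P.full_π e (b := true) hSA (by simp [S, A]) (by simp [S, A])
      (by simp [S, A])
  · rw [hTA _ hd₄.symm, hSA _ hd₄.symm, P.apply_base]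
  · intro x y
    rw [hσ, Perm.sameCycle_conj, hRF, hFg, hFg]
  · intro j hj
    have hj' : 5 ≤ Fintype.card {x // P.label x = j} := by
      rw [hcard] at hj
      split_ifs at hj with hji
      · rw [hji]; exact hk
      · exact hj
    obtain ⟨h₁, h₂, h₃, h₄, h₅⟩ := P.apply_loop j hj'
    have hne : P.loop j ≠ e := by
      by_cases hji : j = i
      · rw [hji]; exact hd₅.symm
      · intro h
        exact hji (by rw [← h₂, h, hd₃])
    rw [hTA _ hne, hSA _ hne]
    exact ⟨congrArg _ h₁, h₂, h₃, by simpa using h₄, by simpa using h₅⟩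
  · have hu : (Finset.univ : Finset ι).val = i ::ₘ (Finset.univ.erase i).val := by
      rw [Finset.erase_val, Multiset.cons_erase (Finset.mem_univ i)]
    rw [hu, Multiset.map_cons] at hP ⊢
    rw [hcard, if_pos rfl, ← Multiset.cons_inj_right _ |>.1 hP]
    congr 1
    refine Multiset.map_congr rfl fun j hj => ?_
    rw [hcard, if_neg (Finset.ne_of_mem_erase hj), add_zero]

theorem Equiv.Perm.cycleType_eq_of_labelling {α ι : Type*} [Fintype α] [DecidableEq α]
    [Nonempty α] [Fintype ι] [DecidableEq ι] {σ : Perm α} {f : α → ι}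
    (h : ∀ x y, σ.SameCycle x y ↔ f x = f y) :
    σ.cycleType =
      (Finset.univ.val.map fun i => Fintype.card {x // f x = i}).filter (2 ≤ ·) := by
  have hex : ∀ i, ∃ x, 2 ≤ Fintype.card {x // f x = i} → f x = i := by
    intro i
    by_cases hi : 2 ≤ Fintype.card {x // f x = i}
    · obtain ⟨x⟩ := Fintype.card_pos_iff.1 (by omega : 0 < Fintype.card {x // f x = i})
      exact ⟨x, fun _ => x.2⟩
    · exact ⟨Classical.arbitrary α, fun h => absurd h hi⟩
  choose r hr using hex
  let s : Finset ι := Finset.univ.filter fun i => 2 ≤ Fintype.card {x // f x = i}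
  have hs : ∀ {i}, i ∈ s ↔ 2 ≤ Fintype.card {x // f x = i} := by simp [s]
  have hmoved : ∀ i ∈ s, r i ∈ σ.support := by
    intro i hi
    have := Fintype.one_lt_card_iff_nontrivial.1 (hs.1 hi)
    obtain ⟨y, hy⟩ := exists_ne (⟨r i, hr i (hs.1 hi)⟩ : {x // f x = i})
    rw [mem_support]
    intro hfix
    exact hy (Subtype.ext (((h (r i) y).2 ((hr i (hs.1 hi)).trans y.2.symm)).eq_of_left hfix).symm)
  have hcard : ∀ i ∈ s, (σ.cycleOf (r i)).support.card = Fintype.card {x // f x = i} := by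
    intro i hi
    rw [Fintype.card_subtype]
    congr 1
    ext x
    simp [mem_support_cycleOf_iff, hmoved i hi, h, hr i (hs.1 hi), eq_comm, -mem_support]
  have hfac : σ.cycleFactorsFinset = s.image fun i => σ.cycleOf (r i) := by
    ext c
    rw [Finset.mem_image]
    constructor
    · intro hc
      obtain ⟨x, hx⟩ := (mem_cycleFactorsFinset_iff.1 hc).1.nonempty_support
      have hxσ : x ∈ σ.support := mem_cycleFactorsFinset_support_le hc hx
      have hfx : f x ∈ s := by
        refine hs.2 (Fintype.one_lt_card_iff.2 ⟨⟨x, rfl⟩, ⟨σ x, ?_⟩, ?_⟩)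
        · exact ((h _ _).1 (sameCycle_apply_left.2 (SameCycle.refl σ x)))
        · simpa [eq_comm] using hxσ
      refine ⟨f x, hfx, ?_⟩
      rw [cycle_is_cycleOf hx hc]
      exact SameCycle.cycleOf_eq ((h _ _).2 (hr _ (hs.1 hfx)))
    · rintro ⟨i, hi, rfl⟩
      exact cycleOf_mem_cycleFactorsFinset_iff.2 (hmoved i hi)
  have hinj : Set.InjOn (fun i => σ.cycleOf (r i)) s := by
    intro i hi j hj hij
    have hj' : r j ∈ (σ.cycleOf (r i)).support :=
      (congrArg support hij).symm ▸ mem_support_cycleOf_iff.2 ⟨SameCycle.refl _ _, hmoved j hj⟩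
    rw [← hr i (hs.1 hi), ← hr j (hs.1 hj)]
    exact (h _ _).1 (mem_support_cycleOf_iff.1 hj').1
  rw [cycleType_def, hfac, Finset.image_val_of_injOn hinj, Multiset.map_map, Multiset.filter_map]
  exact Multiset.map_congr rfl hcard

theorem Equiv.Perm.IsFull.isCycle {α : Type*} [Nontrivial α] {τ : Perm α} (h : τ.IsFull) :
    τ.IsCycle := by
  obtain ⟨x, y, hxy⟩ := exists_pair_ne α
  exact ⟨x, fun hx => hxy ((h x y).eq_of_left hx), fun y _ => h x y⟩

theorem Equiv.Perm.IsFull.card_support {α : Type*} [Fintype α] [DecidableEq α] [Nontrivial α]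
    {τ : Perm α} (h : τ.IsFull) : τ.support.card = Fintype.card α := by
  rw [← Finset.card_univ]
  congr 1
  refine Finset.eq_univ_of_forall fun x => mem_support.2 fun hx => ?_
  obtain ⟨y, hy⟩ := exists_ne x
  exact hy ((h x y).eq_of_left hx).symm

/-- A permutation whose orbit type, fixed points included, is realizable is a commutator of two
full cycles. -/
theorem Realizable.exists_commutator {n : ℕ} {ρ : Perm (Fin n)}
    (h : Realizable ρ.partition.parts) :
    ∃ τ π : Perm (Fin n), τ.IsFull ∧ π.IsFull ∧ τ⁻¹ * π⁻¹ * τ * π = ρ := by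
  classical
  obtain ⟨α, ι, _, _, _, P, hP⟩ := h
  have : Nonempty α := ⟨P.base⟩
  have hcard : Fintype.card α = Fintype.card (Fin n) := by
    rw [← ρ.partition.parts_sum, ← hP, Finset.sum_map_val, ← Fintype.card_sigma]
    exact Fintype.card_congr (Equiv.sigmaFiberEquiv P.label).symm
  let e : α ≃ Fin n := Fintype.equivOfCardEq hcard
  let E : Perm α ≃* Perm (Fin n) := e.permCongrHom
  have hE : ∀ (τ : Perm α) (x y : Fin n),
      (E τ).SameCycle x y ↔ τ.SameCycle (e.symm x) (e.symm y) := fun τ x y =>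
    exists_congr fun i => by rw [← map_zpow]; exact e.eq_symm_apply.symm
  have hfull : ∀ τ : Perm α, τ.IsFull → (E τ).IsFull := fun τ hτ x y => (hE τ x y).2 (hτ _ _)
  have : Nonempty (Fin n) := ⟨e P.base⟩
  have htype : (E (P.τ⁻¹ * P.π⁻¹ * P.τ * P.π)).cycleType = ρ.cycleType := by
    rw [← Perm.filter_parts_partition_eq_cycleType (σ := ρ), ← hP,
      Perm.cycleType_eq_of_labelling fun x y => (hE _ x y).trans (P.sameCycle_iff _ _)]
    congr 2
    exact funext fun i => Fintype.card_congr (e.symm.subtypeEquiv fun x => Iff.rfl)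
  obtain ⟨g, hg⟩ := isConj_iff.1 (Perm.isConj_iff_cycleType_eq.2 htype)
  refine ⟨g * E P.τ * g⁻¹, g * E P.π * g⁻¹, (hfull _ P.full_τ).conj g, (hfull _ P.full_π).conj g,
    ?_⟩
  rw [← hg]
  simp only [map_mul, map_inv]
  group

theorem realizable_1 : Realizable {1} :=
  realizable_of_word (n := 0) (k := 1) ![0]
    ![0]
    ![0] ![0] ![0]
    (by decide +kernel) (by decide +kernel) (by decide +kernel) (by decide +kernel)
    (by decide +kernel) (by decide +kernel)

theorem realizable_5 : Realizable {5} :=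
  realizable_of_word (n := 4) (k := 1) ![0, 3, 1, 2, 4]
    ![0, 2, 3, 1, 4]
    ![0, 0, 0, 0, 0] ![0] ![4]
    (by decide +kernel) (by decide +kernel) (by decide +kernel) (by decide +kernel)
    (by decide +kernel) (by decide +kernel)

theorem realizable_1_3 : Realizable {1, 3} :=
  realizable_of_word (n := 3) (k := 2) ![0, 2, 1, 3]
    ![0, 2, 1, 3]
    ![0, 1, 1, 1] ![0, 1] ![0, 0]
    (by decide +kernel) (by decide +kernel) (by decide +kernel) (by decide +kernel)
    (by decide +kernel) (by decide +kernel)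

theorem realizable_3_3 : Realizable {3, 3} :=
  realizable_of_word (n := 5) (k := 2) ![0, 3, 4, 1, 2, 5]
    ![0, 3, 4, 1, 2, 5]
    ![0, 1, 0, 1, 0, 1] ![0, 1] ![0, 0]
    (by decide +kernel) (by decide +kernel) (by decide +kernel) (by decide +kernel)
    (by decide +kernel) (by decide +kernel)

theorem realizable_5_3 : Realizable {5, 3} :=
  realizable_of_word (n := 7) (k := 2) ![0, 6, 3, 1, 2, 4, 5, 7]
    ![0, 3, 4, 2, 5, 6, 1, 7]
    ![0, 1, 0, 0, 0, 1, 1, 0] ![0, 1] ![7, 0]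
    (by decide +kernel) (by decide +kernel) (by decide +kernel) (by decide +kernel)
    (by decide +kernel) (by decide +kernel)

theorem realizable_3_3_3 : Realizable {3, 3, 3} :=
  realizable_of_word (n := 8) (k := 3) ![0, 3, 1, 5, 4, 6, 7, 2, 8]
    ![0, 2, 7, 1, 4, 3, 5, 6, 8]
    ![0, 1, 2, 1, 0, 0, 1, 2, 2] ![0, 1, 2] ![0, 0, 0]
    (by decide +kernel) (by decide +kernel) (by decide +kernel) (by decide +kernel)
    (by decide +kernel) (by decide +kernel)

theorem realizable_3_2_2 : Realizable {3, 2, 2} :=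
  realizable_of_word (n := 6) (k := 3) ![0, 4, 5, 2, 3, 1, 6]
    ![0, 5, 3, 4, 1, 2, 6]
    ![0, 1, 2, 0, 0, 1, 2] ![0, 1, 2] ![0, 0, 0]
    (by decide +kernel) (by decide +kernel) (by decide +kernel) (by decide +kernel)
    (by decide +kernel) (by decide +kernel)

theorem realizable_5_2_2 : Realizable {5, 2, 2} :=
  realizable_of_word (n := 8) (k := 3) ![0, 3, 5, 4, 2, 7, 6, 1, 8]
    ![0, 7, 4, 1, 3, 2, 6, 5, 8]
    ![0, 1, 0, 2, 0, 0, 2, 1, 0] ![0, 1, 3] ![8, 0, 0]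
    (by decide +kernel) (by decide +kernel) (by decide +kernel) (by decide +kernel)
    (by decide +kernel) (by decide +kernel)

theorem realizable_1_2_2_1 : Realizable {1, 2, 2, 1} :=
  realizable_of_word (n := 5) (k := 4) ![0, 4, 2, 3, 1, 5]
    ![0, 4, 2, 3, 1, 5]
    ![0, 1, 2, 3, 1, 2] ![0, 1, 2, 3] ![0, 0, 0, 0]
    (by decide +kernel) (by decide +kernel) (by decide +kernel) (by decide +kernel)
    (by decide +kernel) (by decide +kernel)

theorem realizable_2_3_2_3 : Realizable {2, 3, 2, 3} :=
  realizable_of_word (n := 9) (k := 4) ![0, 3, 6, 7, 1, 2, 8, 4, 5, 9]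
    ![0, 4, 5, 1, 7, 8, 2, 3, 6, 9]
    ![0, 1, 2, 3, 2, 3, 1, 0, 3, 1] ![0, 1, 2, 3] ![0, 0, 0, 0]
    (by decide +kernel) (by decide +kernel) (by decide +kernel) (by decide +kernel)
    (by decide +kernel) (by decide +kernel)

theorem realizable_2_2_2_2 : Realizable {2, 2, 2, 2} :=
  realizable_of_word (n := 7) (k := 4) ![0, 4, 6, 5, 2, 1, 3, 7]
    ![0, 5, 4, 6, 1, 3, 2, 7]
    ![0, 1, 2, 3, 2, 0, 3, 1] ![0, 1, 2, 3] ![0, 0, 0, 0]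
    (by decide +kernel) (by decide +kernel) (by decide +kernel) (by decide +kernel)
    (by decide +kernel) (by decide +kernel)

theorem realizable_2_2_2_2_2_2 : Realizable {2, 2, 2, 2, 2, 2} :=
  realizable_of_word (n := 11) (k := 6) ![0, 5, 2, 3, 7, 8, 6, 10, 1, 9, 4, 11]
    ![0, 8, 2, 3, 10, 1, 6, 4, 5, 9, 7, 11]
    ![0, 1, 2, 3, 4, 1, 3, 0, 2, 5, 4, 5] ![0, 1, 2, 3, 4, 9] ![0, 0, 0, 0, 0, 0]
    (by decide +kernel) (by decide +kernel) (by decide +kernel) (by decide +kernel)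
    (by decide +kernel) (by decide +kernel)

theorem realizable_3_2_2_2_2 : Realizable {3, 2, 2, 2, 2} :=
  realizable_of_word (n := 10) (k := 5) ![0, 3, 4, 9, 6, 5, 8, 1, 7, 2, 10]
    ![0, 7, 9, 1, 2, 5, 4, 8, 6, 3, 10]
    ![0, 1, 0, 2, 1, 2, 3, 4, 3, 0, 4] ![0, 1, 3, 6, 7] ![0, 0, 0, 0, 0]
    (by decide +kernel) (by decide +kernel) (by decide +kernel) (by decide +kernel)
    (by decide +kernel) (by decide +kernel)

theorem realizable_4_2 : Realizable {4, 2} :=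
  realizable_of_word (n := 5) (k := 2) ![0, 3, 2, 4, 1, 5]
    ![0, 4, 2, 1, 3, 5]
    ![0, 0, 0, 1, 0, 1] ![0, 3] ![0, 0]
    (by decide +kernel) (by decide +kernel) (by decide +kernel) (by decide +kernel)
    (by decide +kernel) (by decide +kernel)

theorem realizable_4_4 : Realizable {4, 4} :=
  realizable_of_word (n := 7) (k := 2) ![0, 6, 3, 5, 1, 4, 2, 7]
    ![0, 4, 6, 2, 5, 3, 1, 7]
    ![0, 0, 0, 1, 1, 1, 0, 1] ![0, 3] ![0, 0]
    (by decide +kernel) (by decide +kernel) (by decide +kernel) (by decide +kernel)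
    (by decide +kernel) (by decide +kernel)

theorem realizable_6_2 : Realizable {6, 2} :=
  realizable_of_word (n := 7) (k := 2) ![0, 6, 3, 5, 4, 1, 2, 7]
    ![0, 5, 6, 2, 4, 3, 1, 7]
    ![0, 0, 0, 1, 0, 0, 0, 1] ![0, 3] ![1, 0]
    (by decide +kernel) (by decide +kernel) (by decide +kernel) (by decide +kernel)
    (by decide +kernel) (by decide +kernel)

theorem realizable_6_4 : Realizable {6, 4} :=
  realizable_of_word (n := 9) (k := 2) ![0, 8, 3, 7, 5, 6, 1, 2, 4, 9]
    ![0, 6, 7, 2, 8, 4, 5, 3, 1, 9]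
    ![0, 1, 0, 0, 1, 0, 0, 1, 1, 0] ![0, 1] ![9, 0]
    (by decide +kernel) (by decide +kernel) (by decide +kernel) (by decide +kernel)
    (by decide +kernel) (by decide +kernel)

theorem realizable_6_6 : Realizable {6, 6} :=
  realizable_of_word (n := 11) (k := 2) ![0, 2, 3, 5, 9, 4, 10, 6, 7, 1, 8, 11]
    ![0, 9, 1, 2, 5, 3, 7, 8, 10, 4, 6, 11]
    ![0, 0, 1, 1, 0, 1, 0, 0, 1, 1, 1, 0] ![0, 2] ![11, 2]
    (by decide +kernel) (by decide +kernel) (by decide +kernel) (by decide +kernel)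
    (by decide +kernel) (by decide +kernel)

theorem realizable_2_2_2_4 : Realizable {2, 2, 2, 4} :=
  realizable_of_word (n := 9) (k := 4) ![0, 7, 8, 4, 1, 3, 5, 6, 2, 9]
    ![0, 4, 8, 5, 3, 6, 7, 1, 2, 9]
    ![0, 1, 2, 3, 3, 3, 0, 1, 2, 3] ![0, 1, 2, 3] ![0, 0, 0, 0]
    (by decide +kernel) (by decide +kernel) (by decide +kernel) (by decide +kernel)
    (by decide +kernel) (by decide +kernel)

theorem realizable_6_2_2_2 : Realizable {6, 2, 2, 2} :=
  realizable_of_word (n := 11) (k := 4) ![0, 3, 5, 9, 4, 2, 7, 6, 1, 10, 8, 11]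
    ![0, 8, 5, 1, 4, 2, 7, 6, 10, 3, 9, 11]
    ![0, 1, 2, 3, 0, 0, 3, 1, 0, 2, 0, 0] ![0, 1, 2, 3] ![11, 0, 0, 0]
    (by decide +kernel) (by decide +kernel) (by decide +kernel) (by decide +kernel)
    (by decide +kernel) (by decide +kernel)

theorem realizable_4_3_2 : Realizable {4, 3, 2} :=
  realizable_of_word (n := 8) (k := 3) ![0, 2, 7, 5, 6, 3, 1, 4, 8]
    ![0, 6, 1, 5, 7, 3, 4, 2, 8]
    ![0, 0, 1, 1, 2, 0, 0, 2, 1] ![0, 2, 4] ![5, 0, 0]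
    (by decide +kernel) (by decide +kernel) (by decide +kernel) (by decide +kernel)
    (by decide +kernel) (by decide +kernel)

theorem realizable_4_4_3 : Realizable {4, 4, 3} :=
  realizable_of_word (n := 10) (k := 3) ![0, 7, 3, 4, 6, 1, 9, 2, 5, 8, 10]
    ![0, 5, 7, 2, 3, 8, 4, 1, 9, 6, 10]
    ![0, 1, 1, 1, 0, 0, 2, 1, 2, 2, 0] ![0, 1, 6] ![10, 0, 0]
    (by decide +kernel) (by decide +kernel) (by decide +kernel) (by decide +kernel)
    (by decide +kernel) (by decide +kernel)

theorem realizable_6_2_3 : Realizable {6, 2, 3} :=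
  realizable_of_word (n := 10) (k := 3) ![0, 8, 9, 7, 4, 5, 3, 1, 6, 2, 10]
    ![0, 7, 9, 6, 4, 5, 8, 3, 1, 2, 10]
    ![0, 1, 2, 0, 0, 0, 0, 0, 1, 2, 2] ![0, 1, 2] ![4, 0, 0]
    (by decide +kernel) (by decide +kernel) (by decide +kernel) (by decide +kernel)
    (by decide +kernel) (by decide +kernel)

theorem realizable_3_4_6 : Realizable {3, 4, 6} :=
  realizable_of_word (n := 12) (k := 3) ![0, 2, 4, 9, 5, 11, 7, 8, 1, 6, 3, 10, 12]
    ![0, 8, 1, 10, 2, 4, 9, 6, 7, 3, 11, 5, 12]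
    ![0, 1, 2, 2, 2, 0, 1, 2, 2, 0, 1, 1, 2] ![0, 1, 2] ![0, 0, 7]
    (by decide +kernel) (by decide +kernel) (by decide +kernel) (by decide +kernel)
    (by decide +kernel) (by decide +kernel)

theorem realizable_6_6_3 : Realizable {6, 6, 3} :=
  realizable_of_word (n := 14) (k := 3) ![0, 6, 12, 9, 2, 3, 10, 4, 5, 8, 7, 1, 13, 11, 14]
    ![0, 11, 4, 5, 7, 8, 1, 10, 9, 3, 6, 13, 2, 12, 14]
    ![0, 1, 1, 1, 0, 2, 0, 0, 0, 1, 1, 2, 1, 2, 0] ![0, 1, 5] ![14, 2, 0]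
    (by decide +kernel) (by decide +kernel) (by decide +kernel) (by decide +kernel)
    (by decide +kernel) (by decide +kernel)

theorem Realizable.of_eq {m m' : Multiset ℕ} (h : Realizable m) (e : m = m') : Realizable m' :=
  e ▸ h

/-- The admissible orbit types that are not realizable. -/
def IsExceptional (m : Multiset ℕ) : Prop := m = 0 ∨ m = {3} ∨ m = {2, 2} ∨ m = {2, 2, 1}

/-- All parts of `m` are positive, and the number of even parts is even. -/
def IsAdmissible (m : Multiset ℕ) : Prop := (∀ k ∈ m, 0 < k) ∧ Even (m.countP Even)

theorem IsAdmissible.right {b m : Multiset ℕ} (h : IsAdmissible (b + m))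
    (hb : Even (b.countP Even)) : IsAdmissible m :=
  ⟨fun k hk => h.1 k (Multiset.mem_add.2 (Or.inr hk)), by
    simpa [Multiset.countP_add, Nat.even_add, hb] using h.2⟩

theorem Multiset.exists_cons_cons_of_even_countP {m : Multiset ℕ} (h : Even (m.countP Even))
    (hm : ∀ k ∈ m, Even k) {k : ℕ} (hk : k ∈ m) : ∃ l r, m = k ::ₘ l ::ₘ r := by
  obtain ⟨s, rfl⟩ := Multiset.exists_cons_of_mem hk
  have hs : s ≠ 0 := by
    rintro rfl
    rw [Multiset.countP_cons_of_pos _ (hm k hk), Multiset.countP_zero] at h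
    exact absurd h (by decide)
  obtain ⟨l, hl⟩ := Multiset.exists_mem_of_ne_zero hs
  obtain ⟨r, rfl⟩ := Multiset.exists_cons_of_mem hl
  exact ⟨l, r, rfl⟩

theorem realizable_pair {k l : ℕ} (hk : k = 4 ∨ k = 6) (hl : l = 2 ∨ l = 4 ∨ l = 6) :
    Realizable {k, l} := by
  rcases hk with rfl | rfl <;> rcases hl with rfl | rfl | rfl
  · exact realizable_4_2
  · exact realizable_4_4
  · exact realizable_6_4.of_eq (by decide)
  · exact realizable_6_2
  · exact realizable_6_4
  · exact realizable_6_6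

theorem realizable_three_pair {k l : ℕ} (hk : k = 2 ∨ k = 4 ∨ k = 6)
    (hl : l = 2 ∨ l = 4 ∨ l = 6) : Realizable {3, k, l} := by
  rcases hk with rfl | rfl | rfl <;> rcases hl with rfl | rfl | rfl
  · exact realizable_3_2_2
  · exact realizable_4_3_2.of_eq (by decide)
  · exact realizable_6_2_3.of_eq (by decide)
  · exact realizable_4_3_2.of_eq (by decide)
  · exact realizable_4_4_3.of_eq (by decide)
  · exact realizable_3_4_6
  · exact realizable_6_2_3.of_eq (by decide)
  · exact realizable_3_4_6.of_eq (by decide)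
  · exact realizable_6_6_3.of_eq (by decide)

theorem realizable_of_isAdmissible {m : Multiset ℕ} (hm : IsAdmissible m)
    (hx : ¬ IsExceptional m) : Realizable m := by
  induction hN : m.sum using Nat.strong_induction_on generalizing m with
  | _ N ih =>
  subst hN
  have peel : ∀ b r : Multiset ℕ, b + r = m → Realizable b → Even (b.countP Even) → 0 < b.sum →
      ¬ IsExceptional r → Realizable m := by
    rintro b r rfl hb hbe hpos hr
    exact hb.add (ih _ (by rw [Multiset.sum_add]; omega) (hm.right hbe) hr rfl)
  by_cases h₇ : ∃ k ∈ m, 7 ≤ k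
  · obtain ⟨k, hk, h7⟩ := h₇
    obtain ⟨r, rfl⟩ := Multiset.exists_cons_of_mem hk
    obtain ⟨k, rfl⟩ := Nat.exists_eq_add_of_le' (show 2 ≤ k by omega)
    refine Realizable.add_two (ih _ (by simp) ⟨?_, ?_⟩ ?_ rfl) (by omega)
    · intro j hj
      rcases Multiset.mem_cons.1 hj with rfl | hj
      · omega
      · exact hm.1 j (Multiset.mem_cons_of_mem hj)
    · simpa [Multiset.countP_cons, Nat.even_add] using hm.2
    · have hmem := Multiset.mem_cons_self k r
      rintro (h | h | h | h) <;> rw [h] at hmem <;> simp at hmem <;> omega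
  by_cases h₅ : 5 ∈ m
  · obtain ⟨r, rfl⟩ := Multiset.exists_cons_of_mem h₅
    by_cases hr : IsExceptional r
    · rcases hr with rfl | rfl | rfl | rfl
      · exact realizable_5
      · exact realizable_5_3
      · exact realizable_5_2_2
      · exact (realizable_5_2_2.add realizable_1).of_eq (by decide)
    · exact peel {5} r rfl realizable_5 (by decide) (by decide) hr
  by_cases h₁ : 1 ∈ m
  · obtain ⟨r, rfl⟩ := Multiset.exists_cons_of_mem h₁
    by_cases hr : IsExceptional r
    · rcases hr with rfl | rfl | rfl | rfl
      · exact realizable_1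
      · exact realizable_1_3
      · exact absurd (by unfold IsExceptional; decide) hx
      · exact realizable_1_2_2_1
    · exact peel {1} r rfl realizable_1 (by decide) (by decide) hr
  by_cases h₃₃ : {3, 3} ≤ m
  · obtain ⟨r, rfl⟩ := Multiset.le_iff_exists_add.1 h₃₃
    by_cases hr : IsExceptional r
    · rcases hr with rfl | rfl | rfl | rfl
      · exact realizable_3_3
      · exact realizable_3_3_3
      · exact realizable_2_3_2_3.of_eq (by decide)
      · simp at h₁
    · exact peel {3, 3} r rfl realizable_3_3 (by decide) (by decide) hr
  have hparts : ∀ k ∈ m, k = 2 ∨ k = 3 ∨ k = 4 ∨ k = 6 := by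
    intro k hk
    have h₀ := hm.1 k hk
    have h7 : k < 7 := by by_contra h; exact h₇ ⟨k, hk, by omega⟩
    have : k ≠ 5 := by rintro rfl; exact h₅ hk
    have : k ≠ 1 := by rintro rfl; exact h₁ hk
    omega
  have heven : ∀ k, k = 2 ∨ k = 4 ∨ k = 6 → Even k := by
    rintro k (rfl | rfl | rfl) <;> decide
  by_cases h₃ : 3 ∈ m
  · obtain ⟨s, rfl⟩ := Multiset.exists_cons_of_mem h₃
    have hs3 : 3 ∉ s := fun h => h₃₃ (Multiset.cons_le_cons 3 (Multiset.singleton_le.2 h))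
    have hs : ∀ k ∈ s, k = 2 ∨ k = 4 ∨ k = 6 := by
      intro k hk
      have := hparts k (Multiset.mem_cons_of_mem hk)
      have : k ≠ 3 := by rintro rfl; exact hs3 hk
      omega
    have hs0 : s ≠ 0 := by rintro rfl; exact hx (Or.inr (Or.inl rfl))
    obtain ⟨k, hk⟩ := Multiset.exists_mem_of_ne_zero hs0
    obtain ⟨l, r, rfl⟩ := Multiset.exists_cons_cons_of_even_countP
      (hm.right (b := {3}) (by decide)).2 (fun k hk => heven k (hs k hk)) hk
    have hk' := hs k (by simp)
    have hl' := hs l (by simp)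
    by_cases hr : IsExceptional r
    · rcases hr with rfl | rfl | rfl | rfl
      · exact realizable_three_pair hk' hl'
      · simp at hs3
      · by_cases hk₂ : k = 2
        · subst hk₂
          by_cases hl₂ : l = 2
          · subst hl₂
            exact realizable_3_2_2_2_2
          · have hl₄ : l = 4 ∨ l = 6 := by omega
            refine (realizable_3_2_2.add (realizable_pair hl₄ (Or.inl rfl))).of_eq ?_
            rcases hl₄ with rfl | rfl <;> decide
        · have hk₄ : k = 4 ∨ k = 6 := by omega
          refine ((realizable_three_pair (Or.inl rfl) hl').add
            (realizable_pair hk₄ (Or.inl rfl))).of_eq ?_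
          rcases hk₄ with rfl | rfl <;> rcases hl' with rfl | rfl | rfl <;> decide
      · simp at h₁
    · refine peel {3, k, l} r (by simp) (realizable_three_pair hk' hl') ?_ (by simp) hr
      rcases hk' with rfl | rfl | rfl <;> rcases hl' with rfl | rfl | rfl <;> decide
  have hs : ∀ k ∈ m, k = 2 ∨ k = 4 ∨ k = 6 := by
    intro k hk
    have := hparts k hk
    have : k ≠ 3 := by rintro rfl; exact h₃ hk
    omega
  by_cases h₄ : ∃ k ∈ m, 4 ≤ k
  · obtain ⟨k, hk, h4⟩ := h₄
    obtain ⟨l, r, rfl⟩ := Multiset.exists_cons_cons_of_even_countP hm.2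
      (fun k hk => heven k (hs k hk)) hk
    have hk' : k = 4 ∨ k = 6 := by have := hs k hk; omega
    have hl' := hs l (by simp)
    by_cases hr : IsExceptional r
    · rcases hr with rfl | rfl | rfl | rfl
      · exact realizable_pair hk' hl'
      · simp at h₃
      · by_cases hl₂ : l = 2
        · subst hl₂
          rcases hk' with rfl | rfl
          · exact realizable_2_2_2_4.of_eq (by decide)
          · exact realizable_6_2_2_2
        · have hl₄ : l = 4 ∨ l = 6 := by omega
          refine ((realizable_pair hk' (Or.inl rfl)).add
            (realizable_pair hl₄ (Or.inl rfl))).of_eq ?_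
          rcases hk' with rfl | rfl <;> rcases hl₄ with rfl | rfl <;> decide
      · simp at h₁
    · refine peel {k, l} r (by simp) (realizable_pair hk' hl') ?_ (by simp; omega) hr
      rcases hk' with rfl | rfl <;> rcases hl' with rfl | rfl | rfl <;> decide
  have h₂ : ∀ k ∈ m, k = 2 := by
    intro k hk
    have := hs k hk
    by_contra h
    exact h₄ ⟨k, hk, by omega⟩
  obtain ⟨c, rfl⟩ : ∃ c, m = Multiset.replicate c 2 := ⟨_, Multiset.eq_replicate_card.2 h₂⟩
  have hc : Even c := by
    rw [← Multiset.card_replicate c 2, ← Multiset.countP_eq_card.2 fun k hk => heven k (hs k hk)]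
    exact hm.2
  have hc₀ : c ≠ 0 := by rintro rfl; exact hx (Or.inl rfl)
  have hc₂ : c ≠ 2 := by rintro rfl; exact hx (Or.inr (Or.inr (Or.inl rfl)))
  obtain ⟨c, rfl⟩ := Nat.exists_eq_add_of_le (show 4 ≤ c by obtain ⟨a, rfl⟩ := hc; omega)
  rw [Multiset.replicate_add] at *
  by_cases hr : IsExceptional (Multiset.replicate c 2)
  · rcases hr with h | h | h | h <;> rw [h] at h₁ h₃ ⊢
    · exact realizable_2_2_2_2
    · simp at h₃
    · exact realizable_2_2_2_2_2_2
    · simp at h₁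
  · exact peel _ _ rfl realizable_2_2_2_2 (by decide) (by decide) hr

theorem Equiv.Perm.isAdmissible_partition {α : Type*} [Fintype α] [DecidableEq α] {ρ : Perm α}
    (h : ρ.sign = 1) : IsAdmissible ρ.partition.parts := by
  refine ⟨fun k hk => ρ.partition.parts_pos hk, ?_⟩
  have hsum : ∀ s : Multiset ℕ, Even (s.sum + s.card) ↔ Even (s.countP Even) := by
    intro s
    induction s using Multiset.induction_on with
    | empty => simp
    | cons a s ih =>
      rw [Multiset.sum_cons, Multiset.card_cons, Multiset.countP_cons,
        show a + s.sum + (s.card + 1) = (a + 1) + (s.sum + s.card) by ring, Nat.even_add, ih]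
      by_cases ha : Even a <;> simp [ha, Nat.even_add_one]
  have hone : (Multiset.replicate (Fintype.card α - ρ.support.card) 1).countP Even = 0 :=
    Multiset.countP_eq_zero.2 fun a ha => by
      rw [Multiset.eq_of_mem_replicate ha]
      decide
  rw [Perm.parts_partition, Multiset.countP_add, hone, add_zero, ← hsum,
    ← neg_one_pow_eq_one_iff_even (R := ℤˣ) (by decide), ← Perm.sign_of_cycleType, h]

/-- For every `n ≥ 6`, every even permutation on `n` symbols is a commutator
of two `n`-cycles. -/
theorem commutator_of_n_cycles_surjective (n : ℕ) (hn : 6 ≤ n)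
    (ρ : Equiv.Perm (Fin n)) (hρ : ρ ∈ alternatingGroup (Fin n)) :
    ∃ τ π : Equiv.Perm (Fin n),
      τ.IsCycle ∧ τ.support.card = n ∧
      π.IsCycle ∧ π.support.card = n ∧
      τ⁻¹ * π⁻¹ * τ * π = ρ := by
  have hx : ¬ IsExceptional ρ.partition.parts := by
    have hsum : ρ.partition.parts.sum = n := ρ.partition.parts_sum.trans (Fintype.card_fin n)
    rintro (h | h | h | h) <;> rw [h] at hsum <;> simp at hsum <;> omega
  obtain ⟨τ, π, hτ, hπ, h⟩ := (realizable_of_isAdmissible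
    (Perm.isAdmissible_partition (Perm.mem_alternatingGroup.1 hρ)) hx).exists_commutator
  have : Nontrivial (Fin n) := Fin.nontrivial_iff_two_le.2 (by omega)
  exact ⟨τ, π, hτ.isCycle, by simpa using hτ.card_support, hπ.isCycle,
    by simpa using hπ.card_support, h⟩
end

section
/- For every odd n ≥ 5, there exists an n-cycle π in Sₙ with π(1) = 2 such that [σₙ, π] is itself an n-cycle. Explicitly, π = (1 2 4 5 7 ... n n−1 n−3 ... 6 3), going up by 2 from 4 to n and then down by 2 from n−1 to 6, works. -/
open Equiv

theorem isCycle_and_card_support_of_forall_sameCycle {α : Type*} [Fintype α] [DecidableEq α]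
    {f : Perm α} {a : α} (ha : f a ≠ a) (h : ∀ x, f.SameCycle a x) :
    f.IsCycle ∧ f.support.card = Fintype.card α := by
  refine ⟨⟨a, ha, fun x _ => h x⟩, ?_⟩
  rw [← Finset.card_univ]
  congr 1
  ext x
  simpa using mt (h x).apply_eq_self_iff.2 ha

theorem val_finRotate {n : ℕ} (x : Fin n) :
    (finRotate n x : ℕ) = if (x : ℕ) + 1 = n then 0 else (x : ℕ) + 1 := by
  cases n with
  | zero => exact x.elim0
  | succ m => rw [coe_finRotate]; simp [Fin.ext_iff]

/-- The values, with points indexed from `0`, of the cycle that goes up by `2` from `3` and then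
back down by `2` to `2`, for odd `n ≥ 7`. -/
def zigzag (n j : ℕ) : ℕ :=
  if j = 0 then 1 else if j = 1 then 3 else if j = 2 then 0 else if j = 3 then 4
  else if j = 5 then 2 else if j + 1 = n then n - 2
  else if j % 2 = 0 then j + 2 else j - 2

theorem zigzag_lt {n j : ℕ} (hn : 7 ≤ n) (hodd : n % 2 = 1) (hj : j < n) : zigzag n j < n := by
  unfold zigzag
  split_ifs <;> omega

theorem zigzag_injOn {n i j : ℕ} (hn : 7 ≤ n) (hodd : n % 2 = 1) (hi : i < n) (hj : j < n)
    (h : zigzag n i = zigzag n j) : i = j := by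
  unfold zigzag at h
  grind (splits := 30)

/-- `zigzag` as a permutation of `Fin n`. -/
noncomputable def zigzagPerm (n : ℕ) (hn : 7 ≤ n) (hodd : n % 2 = 1) : Perm (Fin n) :=
  Equiv.ofBijective (fun j => ⟨zigzag n j, zigzag_lt hn hodd j.2⟩) <|
    Finite.injective_iff_bijective.1 fun i j h =>
      Fin.ext (zigzag_injOn hn hodd i.2 j.2 (Fin.ext_iff.1 h))

theorem val_zigzagPerm {n : ℕ} (hn : 7 ≤ n) (hodd : n % 2 = 1) (x : Fin n) :
    (zigzagPerm n hn hodd x : ℕ) = zigzag n x := rfl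

theorem zigzagPerm_sameCycle {n : ℕ} (hn : 7 ≤ n) (hodd : n % 2 = 1) (x : Fin n) :
    (zigzagPerm n hn hodd).SameCycle ⟨0, by omega⟩ x := by
  set f := zigzagPerm n hn hodd
  have step (i j : ℕ) (hi : i < n) (hj : j < n) (h : zigzag n i = j) :
      f.SameCycle ⟨i, hi⟩ ⟨j, hj⟩ := ⟨1, Fin.ext (by simpa [f, val_zigzagPerm] using h)⟩
  have h01 := step 0 1 (by omega) (by omega) (by simp [zigzag])
  have h13 := step 1 3 (by omega) (by omega) (by simp [zigzag])
  have h20 := step 2 0 (by omega) (by omega) (by simp [zigzag])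
  have h34 := step 3 4 (by omega) (by omega) (by simp [zigzag])
  have h52 := step 5 2 (by omega) (by omega) (by simp [zigzag])
  obtain ⟨x, hx⟩ := x
  induction x using Nat.strong_induction_on with
  | _ x ih =>
    obtain rfl | rfl | rfl | rfl | rfl | rfl | h : x = 0 ∨ x = 1 ∨ x = 2 ∨ x = 3 ∨ x = 4 ∨ x = 5 ∨
        6 ≤ x := by omega
    · rfl
    · exact h01
    · exact h20.symm
    · exact h01.trans h13
    · exact (h01.trans h13).trans h34
    · exact (h52.trans h20).symm
    · have hprev := ih (x - 2) (by omega) (by omega)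
      rcases Nat.mod_two_eq_zero_or_one x with h2 | h2
      · exact hprev.trans (step _ _ _ _ (by unfold zigzag; split_ifs <;> omega))
      · exact hprev.trans (step _ _ hx _ (by unfold zigzag; split_ifs <;> omega)).symm

theorem commutator_zigzagPerm_apply {n : ℕ} (hn : 7 ≤ n) (hodd : n % 2 = 1) {i j : ℕ}
    (hi : i < n) (hj : j < n)
    (h : (if zigzag n i + 1 = n then 0 else zigzag n i + 1) =
      zigzag n (if j + 1 = n then 0 else j + 1)) :
    ((finRotate n)⁻¹ * (zigzagPerm n hn hodd)⁻¹ * finRotate n * zigzagPerm n hn hodd) ⟨i, hi⟩ =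
      ⟨j, hj⟩ := by
  simp only [Perm.mul_apply, Perm.inv_eq_iff_eq]
  exact Fin.ext (by rw [val_finRotate, val_zigzagPerm, val_zigzagPerm, val_finRotate]; exact h)

theorem commutator_zigzagPerm_sameCycle {n : ℕ} (hn : 9 ≤ n) (hodd : n % 2 = 1) (x : Fin n) :
    ((finRotate n)⁻¹ * (zigzagPerm n (by omega) hodd)⁻¹ * finRotate n *
      zigzagPerm n (by omega) hodd).SameCycle ⟨0, by omega⟩ x := by
  set c := (finRotate n)⁻¹ * (zigzagPerm n (by omega) hodd)⁻¹ * finRotate n *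
    zigzagPerm n (by omega) hodd
  have step (i j : ℕ) (hi : i < n) (hj : j < n)
      (h : (if zigzag n i + 1 = n then 0 else zigzag n i + 1) =
        zigzag n (if j + 1 = n then 0 else j + 1)) : c.SameCycle ⟨i, hi⟩ ⟨j, hj⟩ :=
    ⟨1, commutator_zigzagPerm_apply (by omega) hodd hi hj h⟩
  have h04 := step 0 4 (by omega) (by omega) (by unfold zigzag; grind (splits := 30))
  have h12 := step 1 2 (by omega) (by omega) (by unfold zigzag; grind (splits := 30))
  have h36 := step 3 6 (by omega) (by omega) (by unfold zigzag; grind (splits := 30))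
  have h50 := step 5 0 (by omega) (by omega) (by unfold zigzag; grind (splits := 30))
  have h2 := step 2 (n - 1) (by omega) (by omega) (by unfold zigzag; grind (splits := 30))
  have h1 := step (n - 3) 1 (by omega) (by omega) (by unfold zigzag; grind (splits := 30))
  have hjoin := step (n - 5) (n - 2) (by omega) (by omega) (by unfold zigzag; grind (splits := 30))
  have down (i : ℕ) (hi : i < n) (h7 : 7 ≤ i) (h : i % 2 = 1) :=
    step i (i - 4) hi (by omega) (by unfold zigzag; grind (splits := 30))
  have up (i : ℕ) (hi : i + 7 ≤ n) (h4 : 4 ≤ i) (h : i % 2 = 0) :=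
    step i (i + 4) (by omega) (by omega) (by unfold zigzag; grind (splits := 30))
  have classes (i : ℕ) (hi : i + 1 < n) (hne1 : i ≠ 1) (hne2 : i ≠ 2) :
      c.SameCycle ⟨if i % 4 < 2 then 0 else 3, by split_ifs <;> omega⟩ ⟨i, by omega⟩ := by
    induction i using Nat.strong_induction_on with
    | _ i ih =>
      obtain rfl | rfl | rfl | rfl | rfl | h : i = 0 ∨ i = 3 ∨ i = 4 ∨ i = 5 ∨ i = 6 ∨ 7 ≤ i := by
        omega
      · rfl
      · rfl
      · exact h04
      · exact h50.symm
      · exact h36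
      · have hprev := ih (i - 4) (by omega) (by omega) (by omega) (by omega)
        have hmod : (i - 4) % 4 = i % 4 := by omega
        simp only [hmod] at hprev
        rcases Nat.mod_two_eq_zero_or_one i with h2 | h2
        · have := up (i - 4) (by omega) (by omega) (by omega)
          simp only [Nat.sub_add_cancel (show 4 ≤ i by omega)] at this
          exact hprev.trans this
        · exact hprev.trans (down i (by omega) h h2).symm
  have h03 : c.SameCycle ⟨0, by omega⟩ ⟨3, by omega⟩ := by
    have ha := classes (n - 5) (by omega) (by omega) (by omega)
    have hb := classes (n - 2) (by omega) (by omega) (by omega)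
    have hab := (ha.trans hjoin).trans hb.symm
    obtain h | h : n % 4 = 1 ∨ n % 4 = 3 := by omega
    · simpa [show (n - 5) % 4 = 0 by omega, show (n - 2) % 4 = 3 by omega] using hab
    · simpa [show (n - 5) % 4 = 2 by omega, show (n - 2) % 4 = 1 by omega] using hab.symm
  have main (i : ℕ) (hi : i + 1 < n) (hne1 : i ≠ 1) (hne2 : i ≠ 2) :
      c.SameCycle ⟨0, by omega⟩ ⟨i, by omega⟩ := by
    have := classes i hi hne1 hne2
    split_ifs at this
    · exact this
    · exact h03.trans this
  have h01 := (main (n - 3) (by omega) (by omega) (by omega)).trans h1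
  obtain ⟨x, hx⟩ := x
  obtain rfl | rfl | rfl | ⟨hx1, hx2, hx3⟩ :
      x = 1 ∨ x = 2 ∨ x = n - 1 ∨ x ≠ 1 ∧ x ≠ 2 ∧ x + 1 < n := by omega
  · exact h01
  · exact h01.trans h12
  · exact (h01.trans h12).trans h2
  · exact main x hx3 hx1 hx2

/-- For every odd `n ≥ 5` there is an `n`-cycle `π` with `π(1) = 2`
(0-indexed: `0 ↦ 1`) such that `[σₙ, π]` is itself an `n`-cycle. -/
theorem exists_cycle_commutator_n_cycle (n : ℕ) (hn : 5 ≤ n) (hodd : Odd n) :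
    ∃ π : Equiv.Perm (Fin n),
      π.IsCycle ∧ π.support.card = n ∧
      π ⟨0, by omega⟩ = ⟨1, by omega⟩ ∧
      ((finRotate n)⁻¹ * π⁻¹ * finRotate n * π).IsCycle ∧
      ((finRotate n)⁻¹ * π⁻¹ * finRotate n * π).support.card = n := by
  have hodd' : n % 2 = 1 := Nat.odd_iff.1 hodd
  suffices ∃ π : Perm (Fin n), π ⟨0, by omega⟩ = ⟨1, by omega⟩ ∧
      (∀ x, π.SameCycle ⟨0, by omega⟩ x) ∧
      ((finRotate n)⁻¹ * π⁻¹ * finRotate n * π) ⟨0, by omega⟩ ≠ ⟨0, by omega⟩ ∧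
      ∀ x, ((finRotate n)⁻¹ * π⁻¹ * finRotate n * π).SameCycle ⟨0, by omega⟩ x by
    obtain ⟨π, h1, hπ, hc0, hc⟩ := this
    have hcyc := isCycle_and_card_support_of_forall_sameCycle (by simp [h1]) hπ
    have hcyc' := isCycle_and_card_support_of_forall_sameCycle hc0 hc
    rw [Fintype.card_fin] at hcyc hcyc'
    exact ⟨π, hcyc.1, hcyc.2, h1, hcyc'⟩
  obtain rfl | rfl | h9 : n = 5 ∨ n = 7 ∨ 9 ≤ n := by omega
  · have pow_sameCycle (f : Perm (Fin 5)) (h : ∀ x, ∃ k : Fin 5, (f ^ (k : ℕ)) 0 = x) (x) :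
        f.SameCycle 0 x := (h x).elim fun k hk => ⟨k, by simpa using hk⟩
    exact ⟨c[0, 1, 3, 4, 2], by decide +revert, pow_sameCycle _ (by decide), by decide +revert,
      pow_sameCycle _ (by decide)⟩
  · have pow_sameCycle (f : Perm (Fin 7)) (h : ∀ x, ∃ k : Fin 7, (f ^ (k : ℕ)) 0 = x) (x) :
        f.SameCycle 0 x := (h x).elim fun k hk => ⟨k, by simpa using hk⟩
    exact ⟨c[0, 1, 3, 4, 6, 5, 2], by decide +revert, pow_sameCycle _ (by decide), by decide +revert,
      pow_sameCycle _ (by decide)⟩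
  · refine ⟨zigzagPerm n (by omega) hodd', Fin.ext (by simp [val_zigzagPerm, zigzag]),
      zigzagPerm_sameCycle _ _, ?_, commutator_zigzagPerm_sameCycle h9 hodd'⟩
    rw [commutator_zigzagPerm_apply (j := 4) (by omega) hodd' _ (by omega)
      (by unfold zigzag; grind (splits := 30))]
    simp [Fin.ext_iff]
end

section
/- For every odd n ≥ 5, there exists an (n+4)-cycle π in Sₙ₊₄ with π(1) = 2 such that [σₙ₊₄, π] has cycle type (n, 2, 2), and the commutator contains the transpositions (2 n+2) and (4 n+3). -/
open Equiv Equiv.Perm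

/-- A permutation that is transitive on its non-fixed points, in the sense that these all lie in
the class of `x` for every equivalence relation containing the graph of the permutation. -/
theorem sameCycle_of_forall_equivalence {N : ℕ} [NeZero N] (τ : Perm (Fin N)) (s : Set ℕ)
    (c : ℕ → ℕ) (hc : ∀ x < N, x ∈ s → c x < N ∧ (τ (Fin.ofNat N x) : ℕ) = c x)
    (hconn : ∀ r : ℕ → ℕ → Prop, Equivalence r → (∀ x < N, x ∈ s → r x (c x)) →
      ∀ x < N, x ∈ s → r 0 x) (x : Fin N) (hx : (x : ℕ) ∈ s) :
    τ.SameCycle 0 x := by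
  have h := hconn (fun a b => τ.SameCycle (Fin.ofNat N a) (Fin.ofNat N b))
    ⟨fun _ => SameCycle.refl _ _, fun h => h.symm, fun h₁ h₂ => h₁.trans h₂⟩
    (fun y hy hys => by
      obtain ⟨h₁, h₂⟩ := hc y hy hys
      refine ⟨1, ?_⟩
      rw [zpow_one]
      exact Fin.ext (h₂.trans (Nat.mod_eq_of_lt h₁).symm)) x x.isLt hx
  simpa using h

/-- A permutation with two given transpositions that is transitive on the remaining `n` points. -/
theorem cycleType_eq_of_two_swaps {α : Type*} [Fintype α] [DecidableEq α] (κ : Perm α) {n : ℕ}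
    (hn : Fintype.card α = n + 4) (a b d e z : α)
    (hab : a ≠ b) (had : a ≠ d) (hae : a ≠ e) (hbd : b ≠ d) (hbe : b ≠ e) (hde : d ≠ e)
    (hκa : κ a = b) (hκb : κ b = a) (hκd : κ d = e) (hκe : κ e = d)
    (hz : z ∉ ({a, b, d, e} : Finset α)) (hκz : κ z ≠ z)
    (hsame : ∀ δ : Perm α, (∀ x ∉ ({a, b, d, e} : Finset α), δ x = κ x) →
      ∀ x ∉ ({a, b, d, e} : Finset α), δ.SameCycle z x) :
    κ.cycleType = {n, 2, 2} := by
  obtain ⟨δ, hδ⟩ : ∃ δ, δ = κ * swap d e * swap a b := ⟨_, rfl⟩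
  have hprod : [δ, swap a b, swap d e].prod = κ := by simp [hδ, mul_assoc]
  have hfix : ∀ x ∈ ({a, b, d, e} : Finset α), δ x = x := by
    simp only [Finset.mem_insert, Finset.mem_singleton]
    rintro x (rfl | rfl | rfl | rfl)
    · simp [hδ, hκb, swap_apply_of_ne_of_ne hbd hbe]
    · simp [hδ, hκa, swap_apply_of_ne_of_ne had hae]
    · simp [hδ, hκe, swap_apply_of_ne_of_ne had.symm hbd.symm]
    · simp [hδ, hκd, swap_apply_of_ne_of_ne hae.symm hbe.symm]
  have heq : ∀ x ∉ ({a, b, d, e} : Finset α), δ x = κ x := by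
    simp only [Finset.mem_insert, Finset.mem_singleton, not_or]
    rintro x ⟨h₁, h₂, h₃, h₄⟩
    simp [hδ, swap_apply_of_ne_of_ne h₁ h₂, swap_apply_of_ne_of_ne h₃ h₄]
  have hδz : δ z ≠ z := by rwa [heq z hz]
  have hsupp : δ.support = ({a, b, d, e} : Finset α)ᶜ := by
    ext x
    rw [mem_support, Finset.mem_compl]
    exact ⟨fun h hx => h (hfix x hx),
      fun hx => (hsame δ heq x hx).apply_eq_self_iff.not.mp hδz⟩
  have hcard : δ.support.card = n := by
    have h4 : ({a, b, d, e} : Finset α).card = 4 := by simp [*]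
    rw [hsupp, Finset.card_compl, hn, h4, Nat.add_sub_cancel]
  have hcycle : δ.IsCycle :=
    ⟨z, hδz, fun y hy => hsame δ heq y fun h => hy (hfix y h)⟩
  rw [cycleType_eq [δ, swap a b, swap d e] hprod]
  · simp [hcard, card_support_swap hab, card_support_swap hde]
    rfl
  · simp [hcycle, isCycle_swap hab, isCycle_swap hde]
  · simp only [List.pairwise_cons, List.mem_cons, List.not_mem_nil, or_false, forall_eq_or_imp,
      forall_eq, false_implies, implies_true, List.Pairwise.nil, and_true,
      disjoint_iff_disjoint_support, support_swap hab, support_swap hde, hsupp]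
    simp +contextual [Finset.disjoint_left, *]

/-- Reduction of the existence statement to arithmetic of two maps `f`, `c` on `{0, …, n + 3}`,
which represent the full cycle and its commutator with the rotation. -/
theorem exists_commutator_of_maps (n : ℕ) (hn : 5 ≤ n) (f c : ℕ → ℕ)
    (hf : ∀ x < n + 4, f x < n + 4) (hc : ∀ x < n + 4, c x < n + 4)
    (hinj : ∀ x < n + 4, ∀ y < n + 4, f x = f y → x = y)
    (hfc : ∀ x < n + 4, (f x + 1) % (n + 4) = f ((c x + 1) % (n + 4)))
    (hf0 : f 0 = 1) (hc0 : c 0 ≠ 0)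
    (hc1 : c 1 = n + 1) (hc2 : c (n + 1) = 1) (hc3 : c 3 = n + 2) (hc4 : c (n + 2) = 3)
    (hfconn : ∀ r : ℕ → ℕ → Prop, Equivalence r → (∀ x < n + 4, r x (f x)) →
      ∀ x < n + 4, r 0 x)
    (hcconn : ∀ r : ℕ → ℕ → Prop, Equivalence r →
      (∀ x < n + 4, x ≠ 1 → x ≠ n + 1 → x ≠ 3 → x ≠ n + 2 → r x (c x)) →
      ∀ x < n + 4, x ≠ 1 → x ≠ n + 1 → x ≠ 3 → x ≠ n + 2 → r 0 x) :
    ∃ π : Equiv.Perm (Fin (n + 4)),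
      π.IsCycle ∧ π.support.card = n + 4 ∧
      π ⟨0, by omega⟩ = ⟨1, by omega⟩ ∧
      ((finRotate (n + 4))⁻¹ * π⁻¹ * finRotate (n + 4) * π).cycleType
        = ({n, 2, 2} : Multiset ℕ) ∧
      ((finRotate (n + 4))⁻¹ * π⁻¹ * finRotate (n + 4) * π) ⟨1, by omega⟩
        = ⟨n + 1, by omega⟩ ∧
      ((finRotate (n + 4))⁻¹ * π⁻¹ * finRotate (n + 4) * π) ⟨n + 1, by omega⟩
        = ⟨1, by omega⟩ ∧
      ((finRotate (n + 4))⁻¹ * π⁻¹ * finRotate (n + 4) * π) ⟨3, by omega⟩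
        = ⟨n + 2, by omega⟩ ∧
      ((finRotate (n + 4))⁻¹ * π⁻¹ * finRotate (n + 4) * π) ⟨n + 2, by omega⟩
        = ⟨3, by omega⟩ := by
  have hbij : Function.Bijective
      (fun x : Fin (n + 4) => (⟨f x, hf x x.isLt⟩ : Fin (n + 4))) := by
    rw [← Finite.injective_iff_bijective]
    intro x y hxy
    exact Fin.ext (hinj x x.isLt y y.isLt (congrArg Fin.val hxy))
  obtain ⟨π, hπ⟩ : ∃ π : Perm (Fin (n + 4)), ∀ x, (π x : ℕ) = f x :=
    ⟨Equiv.ofBijective _ hbij, fun _ => rfl⟩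
  set κ := (finRotate (n + 4))⁻¹ * π⁻¹ * finRotate (n + 4) * π with hκ
  have hrot : ∀ x : Fin (n + 4), (finRotate (n + 4) x : ℕ) = (x + 1) % (n + 4) := by
    intro x
    rw [finRotate_apply, Fin.val_add]
    simp
  have hκc : ∀ x : Fin (n + 4), (κ x : ℕ) = c x := by
    intro x
    suffices h : κ x = ⟨c x, hc x x.isLt⟩ by rw [h]
    simp only [hκ, Perm.mul_apply]
    rw [Perm.inv_eq_iff_eq, Perm.inv_eq_iff_eq]
    apply Fin.ext
    rw [hrot, hπ, hπ, hrot]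
    exact hfc x x.isLt
  have hκ1 : κ ⟨1, by omega⟩ = ⟨n + 1, by omega⟩ := Fin.ext ((hκc _).trans hc1)
  have hκ2 : κ ⟨n + 1, by omega⟩ = ⟨1, by omega⟩ := Fin.ext ((hκc _).trans hc2)
  have hκ3 : κ ⟨3, by omega⟩ = ⟨n + 2, by omega⟩ := Fin.ext ((hκc _).trans hc3)
  have hκ4 : κ ⟨n + 2, by omega⟩ = ⟨3, by omega⟩ := Fin.ext ((hκc _).trans hc4)
  have hπ0 : π ⟨0, by omega⟩ = ⟨1, by omega⟩ := Fin.ext ((hπ _).trans hf0)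
  have hsame : ∀ x, π.SameCycle 0 x := fun x =>
    sameCycle_of_forall_equivalence π Set.univ f
      (fun y hy _ => ⟨hf y hy, by rw [hπ]; simp [Nat.mod_eq_of_lt hy]⟩)
      (fun r hr h y hy _ => hfconn r hr (fun z hz => h z hz trivial) y hy) x trivial
  have hπ0' : π 0 ≠ 0 := by
    intro h
    have := hπ0.symm.trans h
    simp at this
  refine ⟨π, ⟨0, hπ0', fun y _ => hsame y⟩, ?_, hπ0, ?_, hκ1, hκ2, hκ3, hκ4⟩
  · have : π.support = Finset.univ := by
      ext x
      simpa using (hsame x).apply_eq_self_iff.not.mp hπ0'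
    rw [this, Finset.card_univ, Fintype.card_fin]
  obtain ⟨a, ha⟩ : ∃ a : Fin (n + 4), (a : ℕ) = 1 := ⟨⟨1, by omega⟩, rfl⟩
  obtain ⟨b, hb⟩ : ∃ b : Fin (n + 4), (b : ℕ) = n + 1 := ⟨⟨n + 1, by omega⟩, rfl⟩
  obtain ⟨d, hd⟩ : ∃ d : Fin (n + 4), (d : ℕ) = 3 := ⟨⟨3, by omega⟩, rfl⟩
  obtain ⟨e, he⟩ : ∃ e : Fin (n + 4), (e : ℕ) = n + 2 := ⟨⟨n + 2, by omega⟩, rfl⟩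
  have hab : a ≠ b := by rw [Ne, Fin.ext_iff]; omega
  have had : a ≠ d := by rw [Ne, Fin.ext_iff]; omega
  have hae : a ≠ e := by rw [Ne, Fin.ext_iff]; omega
  have hbd : b ≠ d := by rw [Ne, Fin.ext_iff]; omega
  have hbe : b ≠ e := by rw [Ne, Fin.ext_iff]; omega
  have hde : d ≠ e := by rw [Ne, Fin.ext_iff]; omega
  have hκa : κ a = b := Fin.ext (by rw [hκc, ha, hc1, hb])
  have hκb : κ b = a := Fin.ext (by rw [hκc, hb, hc2, ha])
  have hκd : κ d = e := Fin.ext (by rw [hκc, hd, hc3, he])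
  have hκe : κ e = d := Fin.ext (by rw [hκc, he, hc4, hd])
  have hx4 : ∀ x : Fin (n + 4), x ∉ ({a, b, d, e} : Finset (Fin (n + 4))) ↔
      (x : ℕ) ≠ 1 ∧ (x : ℕ) ≠ n + 1 ∧ (x : ℕ) ≠ 3 ∧ (x : ℕ) ≠ n + 2 := by
    intro x
    simp only [Finset.mem_insert, Finset.mem_singleton, not_or, Fin.ext_iff, ha, hb, hd, he]
  refine cycleType_eq_of_two_swaps κ (Fintype.card_fin _) a b d e 0 hab had hae hbd hbe hde
    hκa hκb hκd hκe ((hx4 0).mpr ?_) ?_ ?_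
  · rw [Fin.val_zero]
    omega
  · rw [Ne, Fin.ext_iff, hκc]
    exact hc0
  · intro δ hδ x hx
    refine sameCycle_of_forall_equivalence δ {y | y ≠ 1 ∧ y ≠ n + 1 ∧ y ≠ 3 ∧ y ≠ n + 2} c
      (fun y hy hys => ⟨hc y hy, ?_⟩)
      (fun r hr h y hy ⟨k₁, k₂, k₃, k₄⟩ =>
        hcconn r hr (fun z hz l₁ l₂ l₃ l₄ => h z hz ⟨l₁, l₂, l₃, l₄⟩) y hy k₁ k₂ k₃ k₄)
      x ((hx4 x).mp hx)
    have hy' : ((Fin.ofNat (n + 4) y : Fin (n + 4)) : ℕ) = y := Nat.mod_eq_of_lt hy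
    rw [hδ _ ((hx4 _).mpr (by rw [hy']; exact hys)), hκc, hy']

/-- The full cycle on `{0, …, N - 1}` in the case `N ≡ 1 mod 4`. -/
def cycleMapOne (N x : ℕ) : ℕ :=
  if x = 0 then 1 else if x = 1 then 5 else if x = 2 then 0 else if x = 3 then 2
  else if x = 4 then 7 else if x + 4 = N then 4 else if x + 3 = N then N - 1
  else if x + 2 = N then 6 else if x + 1 = N then 3
  else if x % 2 = 1 then x + 4 else x + 2

/-- The commutator of the rotation with `cycleMapOne`. -/
def commMapOne (N x : ℕ) : ℕ :=
  if x = 0 then 2 else if x = 1 then N - 3 else if x = 2 then N - 1 else if x = 3 then N - 2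
  else if x = 4 then 5 else if x + 4 = N then 0 else if x + 3 = N then 1
  else if x + 2 = N then 3 else if x + 1 = N then N - 5
  else if x % 2 = 1 then x + 2 else x - 2

/-- The full cycle on `{0, …, N - 1}` in the case `N ≡ 3 mod 4`. -/
def cycleMapThree (N x : ℕ) : ℕ :=
  if x = 0 then 1 else if x = 1 then 4 else if x = 2 then 8 else if x = 3 then 2
  else if x = 4 then 6 else if x = 5 then N - 1 else if x + 5 = N then N - 2
  else if x + 4 = N then 0 else if x + 3 = N then 7 else if x + 2 = N then 5
  else if x + 1 = N then 3 else if x % 2 = 0 then x + 4 else x + 2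

/-- The commutator of the rotation with `cycleMapThree`. -/
def commMapThree (N x : ℕ) : ℕ :=
  if x = 0 then 2 else if x = 1 then N - 3 else if x = 2 then (if N = 11 then 5 else 6)
  else if x = 3 then N - 2 else if x = 4 then N - 4 else if x = 5 then N - 5
  else if x + 7 = N then N - 6 else if x + 5 = N then 4 else if x + 4 = N then N - 1
  else if x + 3 = N then 1 else if x + 2 = N then 3 else if x + 1 = N then 0
  else if x % 2 = 0 then x + 2 else x - 2

/-- The inverse of `cycleMapOne`. -/
def cycleMapOneInv (N y : ℕ) : ℕ :=
  if y = 0 then 2 else if y = 1 then 0 else if y = 2 then 3 else if y = 3 then N - 1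
  else if y = 4 then N - 4 else if y = 5 then 1 else if y = 6 then N - 2 else if y = 7 then 4
  else if y + 1 = N then N - 3 else if y % 2 = 1 then y - 4 else y - 2

/-- The inverse of `cycleMapThree`. -/
def cycleMapThreeInv (N y : ℕ) : ℕ :=
  if y = 0 then N - 4 else if y = 1 then 0 else if y = 2 then 3 else if y = 3 then N - 1
  else if y = 4 then 1 else if y = 5 then N - 2 else if y = 6 then 4 else if y = 7 then N - 3
  else if y = 8 then 2 else if y + 1 = N then 5 else if y + 2 = N then N - 5
  else if y % 2 = 0 then y - 4 else y - 2

theorem succ_mod_eq_ite {N y : ℕ} (hy : y < N) :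
    (y + 1) % N = if y + 1 = N then 0 else y + 1 := by
  split_ifs with h
  · rw [h, Nat.mod_self]
  · exact Nat.mod_eq_of_lt (by omega)

theorem cycleMapOne_lt {N x : ℕ} (hN : 9 ≤ N) (h : N % 4 = 1) (hx : x < N) :
    cycleMapOne N x < N := by
  fun_cases cycleMapOne N x <;> omega

theorem commMapOne_lt {N x : ℕ} (hN : 9 ≤ N) (h : N % 4 = 1) (hx : x < N) :
    commMapOne N x < N := by
  fun_cases commMapOne N x <;> omega

theorem cycleMapOneInv_cycleMapOne {N x : ℕ} (hN : 9 ≤ N) (h : N % 4 = 1) :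
    cycleMapOneInv N (cycleMapOne N x) = x := by
  fun_cases cycleMapOne N x <;> grind (splits := 40) [cycleMapOneInv]

/-- `commMapOne` is the commutator of the rotation with `cycleMapOne`. -/
theorem cycleMapOne_succ {N x : ℕ} (hN : 9 ≤ N) (h : N % 4 = 1) (hx : x < N) :
    (cycleMapOne N x + 1) % N = cycleMapOne N ((commMapOne N x + 1) % N) := by
  rw [succ_mod_eq_ite (cycleMapOne_lt hN h hx), succ_mod_eq_ite (commMapOne_lt hN h hx)]
  fun_cases commMapOne N x <;> grind (splits := 40) [cycleMapOne]

theorem cycleMapThree_lt {N x : ℕ} (hN : 9 ≤ N) (h : N % 4 = 3) (hx : x < N) :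
    cycleMapThree N x < N := by
  fun_cases cycleMapThree N x <;> omega

theorem commMapThree_lt {N x : ℕ} (hN : 9 ≤ N) (h : N % 4 = 3) (hx : x < N) :
    commMapThree N x < N := by
  fun_cases commMapThree N x <;> omega

theorem cycleMapThreeInv_cycleMapThree {N x : ℕ} (hN : 9 ≤ N) (h : N % 4 = 3) :
    cycleMapThreeInv N (cycleMapThree N x) = x := by
  fun_cases cycleMapThree N x <;> grind (splits := 40) [cycleMapThreeInv]

/-- `commMapThree` is the commutator of the rotation with `cycleMapThree`. -/
theorem cycleMapThree_succ {N x : ℕ} (hN : 9 ≤ N) (h : N % 4 = 3) (hx : x < N) :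
    (cycleMapThree N x + 1) % N = cycleMapThree N ((commMapThree N x + 1) % N) := by
  rw [succ_mod_eq_ite (cycleMapThree_lt hN h hx), succ_mod_eq_ite (commMapThree_lt hN h hx)]
  fun_cases commMapThree N x <;> grind (splits := 40) [cycleMapThree]

theorem rel_of_rel_add {r : ℕ → ℕ → Prop} (hr : Equivalence r) {s t k : ℕ}
    (h : ∀ x, s ≤ x → x + k ≤ t → k ∣ x - s → r x (x + k)) (x : ℕ) (hsx : s ≤ x) (hxt : x ≤ t)
    (hk : k ∣ x - s) : r s x := by
  obtain ⟨i, hi⟩ := hk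
  obtain rfl : x = s + k * i := by omega
  clear hi hsx
  induction i with
  | zero => exact hr.refl s
  | succ i ih =>
    rw [Nat.mul_succ, ← Nat.add_assoc] at hxt ⊢
    exact hr.trans (ih (by omega)) (h _ (by omega) hxt (by simp))

/-- If `g` acts as `x ↦ x + k` on an arithmetic progression starting in the class of `0`, the whole
progression lies in that class. -/
theorem rel_zero_of_ascending {r : ℕ → ℕ → Prop} {g : ℕ → ℕ} {P : ℕ → Prop} (hr : Equivalence r)
    (hg : ∀ x, P x → r x (g x)) (s t k : ℕ)
    (h : ∀ x, s ≤ x → x + k ≤ t → k ∣ x - s → P x ∧ g x = x + k) (hs : r 0 s)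
    (x : ℕ) (hsx : s ≤ x) (hxt : x ≤ t) (hk : k ∣ x - s) : r 0 x :=
  hr.trans hs (rel_of_rel_add hr
    (fun z h₁ h₂ h₃ => (h z h₁ h₂ h₃).2 ▸ hg z (h z h₁ h₂ h₃).1) x hsx hxt hk)

/-- If `g` acts as `x + k ↦ x` on an arithmetic progression ending in the class of `0`, the whole
progression lies in that class. -/
theorem rel_zero_of_descending {r : ℕ → ℕ → Prop} {g : ℕ → ℕ} {P : ℕ → Prop} (hr : Equivalence r)
    (hg : ∀ x, P x → r x (g x)) (s t k : ℕ) (hst : s ≤ t) (hkst : k ∣ t - s)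
    (h : ∀ x, s ≤ x → x + k ≤ t → k ∣ x - s → P (x + k) ∧ g (x + k) = x) (ht : r 0 t)
    (x : ℕ) (hsx : s ≤ x) (hxt : x ≤ t) (hk : k ∣ x - s) : r 0 x := by
  have key := rel_of_rel_add (t := t) hr (fun z h₁ h₂ h₃ => by
    obtain ⟨hz, hgz⟩ := h z h₁ h₂ h₃
    have := hg _ hz
    rw [hgz] at this
    exact hr.symm this)
  exact hr.trans (hr.trans ht (hr.symm (key t hst le_rfl hkst))) (key x hsx hxt hk)

/-- `cycleMapOne` has a single orbit. -/
theorem cycleMapOne_connected {N : ℕ} (hN : 9 ≤ N) (h : N % 4 = 1) {r : ℕ → ℕ → Prop}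
    (hr : Equivalence r) (hg : ∀ x, x < N → r x (cycleMapOne N x))
    (x : ℕ) (hx : x < N) : r 0 x := by
  have step : ∀ y z, y < N → cycleMapOne N y = z → r 0 y → r 0 z :=
    fun y z hy hz h0 => hr.trans h0 (hz ▸ hg y hy)
  have h1 : r 0 1 := step 0 1 (by omega)
    (by fun_cases cycleMapOne N 0 <;> omega) (hr.refl 0)
  have h5 : r 0 5 := step 1 5 (by omega)
    (by fun_cases cycleMapOne N 1 <;> omega) h1
  have run5 := rel_zero_of_ascending hr hg 5 (N - 4) 4 (fun y _ _ _ =>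
    ⟨by omega, by fun_cases cycleMapOne N y <;> omega⟩) h5
  have h4 : r 0 4 := step (N - 4) 4 (by omega)
    (by fun_cases cycleMapOne N (N - 4) <;> omega) (run5 _ (by omega) (by omega) (by omega))
  have h7 : r 0 7 := step 4 7 (by omega)
    (by fun_cases cycleMapOne N 4 <;> omega) h4
  have run7 := rel_zero_of_ascending hr hg 7 (N - 2) 4 (fun y _ _ _ =>
    ⟨by omega, by fun_cases cycleMapOne N y <;> omega⟩) h7
  have h6 : r 0 6 := step (N - 2) 6 (by omega)
    (by fun_cases cycleMapOne N (N - 2) <;> omega) (run7 _ (by omega) (by omega) (by omega))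
  have run6 := rel_zero_of_ascending hr hg 6 (N - 3) 2 (fun y _ _ _ =>
    ⟨by omega, by fun_cases cycleMapOne N y <;> omega⟩) h6
  have htop1 : r 0 (N - 1) := step (N - 3) (N - 1) (by omega)
    (by fun_cases cycleMapOne N (N - 3) <;> omega) (run6 _ (by omega) (by omega) (by omega))
  have h3 : r 0 3 := step (N - 1) 3 (by omega)
    (by fun_cases cycleMapOne N (N - 1) <;> omega) htop1
  have h2 : r 0 2 := step 3 2 (by omega)
    (by fun_cases cycleMapOne N 3 <;> omega) h3
  have cases : x = 0 ∨ x = 1 ∨ (5 ≤ x ∧ x ≤ N - 4 ∧ 4 ∣ x - 5) ∨ x = 4 ∨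
      (7 ≤ x ∧ x ≤ N - 2 ∧ 4 ∣ x - 7) ∨ (6 ≤ x ∧ x ≤ N - 3 ∧ 2 ∣ x - 6) ∨ x = N - 1 ∨ x = 3 ∨
      x = 2 := by omega
  rcases cases with rfl | rfl | ⟨a, b, c⟩ | rfl | ⟨a, b, c⟩ | ⟨a, b, c⟩ | rfl | rfl | rfl
  exacts [hr.refl 0, h1, run5 x a b c, h4, run7 x a b c, run6 x a b c, htop1, h3, h2]

/-- `commMapOne` has a single orbit outside its two transpositions. -/
theorem commMapOne_connected {N : ℕ} (hN : 9 ≤ N) (h : N % 4 = 1) {r : ℕ → ℕ → Prop}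
    (hr : Equivalence r) (hg : ∀ x, x < N ∧ x ≠ 1 ∧ x ≠ N - 3 ∧ x ≠ 3 ∧ x ≠ N - 2 →
      r x (commMapOne N x))
    (x : ℕ) (hx : x < N ∧ x ≠ 1 ∧ x ≠ N - 3 ∧ x ≠ 3 ∧ x ≠ N - 2) : r 0 x := by
  have step : ∀ y z, y < N ∧ y ≠ 1 ∧ y ≠ N - 3 ∧ y ≠ 3 ∧ y ≠ N - 2 →
      commMapOne N y = z → r 0 y → r 0 z :=
    fun y z hy hz h0 => hr.trans h0 (hz ▸ hg y hy)
  have h2 : r 0 2 := step 0 2 (by omega)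
    (by fun_cases commMapOne N 0 <;> omega) (hr.refl 0)
  have htop1 : r 0 (N - 1) := step 2 (N - 1) (by omega)
    (by fun_cases commMapOne N 2 <;> omega) h2
  have htop5 : r 0 (N - 5) := step (N - 1) (N - 5) (by omega)
    (by fun_cases commMapOne N (N - 1) <;> omega) htop1
  have run4 := rel_zero_of_descending hr hg 4 (N - 5) 2 (by omega) (by omega)
    (fun y _ _ _ => ⟨by omega, by fun_cases commMapOne N (y + 2) <;> omega⟩) htop5
  have h5 : r 0 5 := step 4 5 (by omega)
    (by fun_cases commMapOne N 4 <;> omega) (run4 _ (by omega) (by omega) (by omega))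
  have run5 := rel_zero_of_ascending hr hg 5 (N - 4) 2 (fun y _ _ _ =>
    ⟨by omega, by fun_cases commMapOne N y <;> omega⟩) h5
  have cases : x = 0 ∨ x = 2 ∨ x = N - 1 ∨ (4 ≤ x ∧ x ≤ N - 5 ∧ 2 ∣ x - 4) ∨
      (5 ≤ x ∧ x ≤ N - 4 ∧ 2 ∣ x - 5) := by omega
  rcases cases with rfl | rfl | rfl | ⟨a, b, c⟩ | ⟨a, b, c⟩
  exacts [hr.refl 0, h2, htop1, run4 x a b c, run5 x a b c]

/-- `cycleMapThree` has a single orbit. -/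
theorem cycleMapThree_connected {N : ℕ} (hN : 9 ≤ N) (h : N % 4 = 3) {r : ℕ → ℕ → Prop}
    (hr : Equivalence r) (hg : ∀ x, x < N → r x (cycleMapThree N x))
    (x : ℕ) (hx : x < N) : r 0 x := by
  have step : ∀ y z, y < N → cycleMapThree N y = z → r 0 y → r 0 z :=
    fun y z hy hz h0 => hr.trans h0 (hz ▸ hg y hy)
  have h1 : r 0 1 := step 0 1 (by omega)
    (by fun_cases cycleMapThree N 0 <;> omega) (hr.refl 0)
  have h4 : r 0 4 := step 1 4 (by omega)
    (by fun_cases cycleMapThree N 1 <;> omega) h1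
  have h6 : r 0 6 := step 4 6 (by omega)
    (by fun_cases cycleMapThree N 4 <;> omega) h4
  have run6 := rel_zero_of_ascending hr hg 6 (N - 5) 4 (fun y _ _ _ =>
    ⟨by omega, by fun_cases cycleMapThree N y <;> omega⟩) h6
  have htop2 : r 0 (N - 2) := step (N - 5) (N - 2) (by omega)
    (by fun_cases cycleMapThree N (N - 5) <;> omega) (run6 _ (by omega) (by omega) (by omega))
  have h5 : r 0 5 := step (N - 2) 5 (by omega)
    (by fun_cases cycleMapThree N (N - 2) <;> omega) htop2
  have htop1 : r 0 (N - 1) := step 5 (N - 1) (by omega)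
    (by fun_cases cycleMapThree N 5 <;> omega) h5
  have h3 : r 0 3 := step (N - 1) 3 (by omega)
    (by fun_cases cycleMapThree N (N - 1) <;> omega) htop1
  have h2 : r 0 2 := step 3 2 (by omega)
    (by fun_cases cycleMapThree N 3 <;> omega) h3
  have h8 : r 0 8 := step 2 8 (by omega)
    (by fun_cases cycleMapThree N 2 <;> omega) h2
  have run8 := rel_zero_of_ascending hr hg 8 (N - 3) 4 (fun y _ _ _ =>
    ⟨by omega, by fun_cases cycleMapThree N y <;> omega⟩) h8
  have h7 : r 0 7 := step (N - 3) 7 (by omega)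
    (by fun_cases cycleMapThree N (N - 3) <;> omega) (run8 _ (by omega) (by omega) (by omega))
  have run7 := rel_zero_of_ascending hr hg 7 (N - 4) 2 (fun y _ _ _ =>
    ⟨by omega, by fun_cases cycleMapThree N y <;> omega⟩) h7
  have cases : x = 0 ∨ x = 1 ∨ x = 4 ∨ (6 ≤ x ∧ x ≤ N - 5 ∧ 4 ∣ x - 6) ∨ x = N - 2 ∨ x = 5 ∨
      x = N - 1 ∨ x = 3 ∨ x = 2 ∨ (8 ≤ x ∧ x ≤ N - 3 ∧ 4 ∣ x - 8) ∨
      (7 ≤ x ∧ x ≤ N - 4 ∧ 2 ∣ x - 7) := by omega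
  rcases cases with rfl | rfl | rfl | ⟨a, b, c⟩ | rfl | rfl | rfl | rfl | rfl | ⟨a, b, c⟩ |
    ⟨a, b, c⟩
  exacts [hr.refl 0, h1, h4, run6 x a b c, htop2, h5, htop1, h3, h2, run8 x a b c, run7 x a b c]

/-- `commMapThree` has a single orbit outside its two transpositions. -/
theorem commMapThree_connected {N : ℕ} (hN : 9 ≤ N) (h : N % 4 = 3) {r : ℕ → ℕ → Prop}
    (hr : Equivalence r) (hg : ∀ x, x < N ∧ x ≠ 1 ∧ x ≠ N - 3 ∧ x ≠ 3 ∧ x ≠ N - 2 →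
      r x (commMapThree N x))
    (x : ℕ) (hx : x < N ∧ x ≠ 1 ∧ x ≠ N - 3 ∧ x ≠ 3 ∧ x ≠ N - 2) : r 0 x := by
  have step : ∀ y z, y < N ∧ y ≠ 1 ∧ y ≠ N - 3 ∧ y ≠ 3 ∧ y ≠ N - 2 →
      commMapThree N y = z → r 0 y → r 0 z :=
    fun y z hy hz h0 => hr.trans h0 (hz ▸ hg y hy)
  have h2 : r 0 2 := step 0 2 (by omega)
    (by fun_cases commMapThree N 0 <;> omega) (hr.refl 0)
  have evens : ∀ y, 6 ≤ y → y ≤ N - 7 → 2 ∣ y - 6 → r 0 y := by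
    intro y h₁ h₂ h₃
    have h6 : r 0 6 := step 2 6 (by omega) (by fun_cases commMapThree N 2 <;> omega) h2
    exact rel_zero_of_ascending hr hg 6 (N - 7) 2 (fun y _ _ _ =>
      ⟨by omega, by fun_cases commMapThree N y <;> omega⟩) h6 y h₁ h₂ h₃
  have htop6 : r 0 (N - 6) := by
    by_cases h11 : N = 11
    · exact step 2 (N - 6) (by omega) (by fun_cases commMapThree N 2 <;> omega) h2
    · exact step (N - 7) (N - 6) (by omega) (by fun_cases commMapThree N (N - 7) <;> omega)
        (evens _ (by omega) (by omega) (by omega))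
  have run5 := rel_zero_of_descending hr hg 5 (N - 6) 2 (by omega) (by omega)
    (fun y _ _ _ => ⟨by omega, by fun_cases commMapThree N (y + 2) <;> omega⟩) htop6
  have htop5 : r 0 (N - 5) := step 5 (N - 5) (by omega)
    (by fun_cases commMapThree N 5 <;> omega) (run5 _ (by omega) (by omega) (by omega))
  have h4 : r 0 4 := step (N - 5) 4 (by omega)
    (by fun_cases commMapThree N (N - 5) <;> omega) htop5
  have htop4 : r 0 (N - 4) := step 4 (N - 4) (by omega)
    (by fun_cases commMapThree N 4 <;> omega) h4
  have htop1 : r 0 (N - 1) := step (N - 4) (N - 1) (by omega)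
    (by fun_cases commMapThree N (N - 4) <;> omega) htop4
  have cases : x = 0 ∨ x = 2 ∨ (6 ≤ x ∧ x ≤ N - 7 ∧ 2 ∣ x - 6) ∨
      (5 ≤ x ∧ x ≤ N - 6 ∧ 2 ∣ x - 5) ∨ x = N - 5 ∨ x = 4 ∨ x = N - 4 ∨ x = N - 1 := by omega
  rcases cases with rfl | rfl | ⟨a, b, c⟩ | ⟨a, b, c⟩ | rfl | rfl | rfl | rfl
  exacts [hr.refl 0, h2, evens x a b c, run5 x a b c, htop5, h4, htop4, htop1]


/-- For every odd `n ≥ 5` there is an `(n+4)`-cycle `π` in `Sₙ₊₄` with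
`π(1) = 2` (0-indexed: `0 ↦ 1`) such that `[σₙ₊₄, π]` has cycle type
`(n, 2, 2)`, and the commutator contains the transpositions `(2 n+2)` and
`(4 n+3)` (0-indexed: `(1 n+1)` and `(3 n+2)`). -/
theorem exists_commutator_cycleType_n_two_two (n : ℕ) (hn : 5 ≤ n) (hodd : Odd n) :
    ∃ π : Equiv.Perm (Fin (n + 4)),
      π.IsCycle ∧ π.support.card = n + 4 ∧
      π ⟨0, by omega⟩ = ⟨1, by omega⟩ ∧
      ((finRotate (n + 4))⁻¹ * π⁻¹ * finRotate (n + 4) * π).cycleType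
        = ({n, 2, 2} : Multiset ℕ) ∧
      ((finRotate (n + 4))⁻¹ * π⁻¹ * finRotate (n + 4) * π) ⟨1, by omega⟩
        = ⟨n + 1, by omega⟩ ∧
      ((finRotate (n + 4))⁻¹ * π⁻¹ * finRotate (n + 4) * π) ⟨n + 1, by omega⟩
        = ⟨1, by omega⟩ ∧
      ((finRotate (n + 4))⁻¹ * π⁻¹ * finRotate (n + 4) * π) ⟨3, by omega⟩
        = ⟨n + 2, by omega⟩ ∧
      ((finRotate (n + 4))⁻¹ * π⁻¹ * finRotate (n + 4) * π) ⟨n + 2, by omega⟩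
        = ⟨3, by omega⟩ := by
  have hN : 9 ≤ n + 4 := by omega
  have hmod : (n + 4) % 4 = 1 ∨ (n + 4) % 4 = 3 := by
    obtain ⟨k, hk⟩ := hodd
    omega
  rcases hmod with h | h
  · exact exists_commutator_of_maps n hn (cycleMapOne (n + 4)) (commMapOne (n + 4))
      (fun x hx => cycleMapOne_lt hN h hx) (fun x hx => commMapOne_lt hN h hx)
      (fun x _ y _ hxy => by
        rw [← cycleMapOneInv_cycleMapOne hN h (x := x), hxy,
          cycleMapOneInv_cycleMapOne hN h])
      (fun x hx => cycleMapOne_succ hN h hx)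
      (by fun_cases cycleMapOne (n + 4) 0 <;> omega)
      (by fun_cases commMapOne (n + 4) 0 <;> omega)
      (by fun_cases commMapOne (n + 4) 1 <;> omega)
      (by fun_cases commMapOne (n + 4) (n + 1) <;> omega)
      (by fun_cases commMapOne (n + 4) 3 <;> omega)
      (by fun_cases commMapOne (n + 4) (n + 2) <;> omega)
      (fun r hr hg => cycleMapOne_connected hN h hr hg)
      (fun r hr hg x hx h₁ h₂ h₃ h₄ => commMapOne_connected hN h hr
        (fun y hy => hg y (by omega) (by omega) (by omega) (by omega) (by omega)) x
        (by omega))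
  · exact exists_commutator_of_maps n hn (cycleMapThree (n + 4)) (commMapThree (n + 4))
      (fun x hx => cycleMapThree_lt hN h hx) (fun x hx => commMapThree_lt hN h hx)
      (fun x _ y _ hxy => by
        rw [← cycleMapThreeInv_cycleMapThree hN h (x := x), hxy,
          cycleMapThreeInv_cycleMapThree hN h])
      (fun x hx => cycleMapThree_succ hN h hx)
      (by fun_cases cycleMapThree (n + 4) 0 <;> omega)
      (by fun_cases commMapThree (n + 4) 0 <;> omega)
      (by fun_cases commMapThree (n + 4) 1 <;> omega)
      (by fun_cases commMapThree (n + 4) (n + 1) <;> omega)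
      (by fun_cases commMapThree (n + 4) 3 <;> omega)
      (by fun_cases commMapThree (n + 4) (n + 2) <;> omega)
      (fun r hr hg => cycleMapThree_connected hN h hr hg)
      (fun r hr hg x hx h₁ h₂ h₃ h₄ => commMapThree_connected hN h hr
        (fun y hy => hg y (by omega) (by omega) (by omega) (by omega) (by omega)) x
        (by omega))
end

section
/- For every k, l ≥ 1 with (k,l) ≠ (1,1), there exists a (2k+2l)-cycle π in S_{2k+2l} with π(1) = 2 such that [σ_{2k+2l}, π] has cycle type (2k, 2l). -/
open Equiv Equiv.Perm

section CycleOn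

variable {V W : Type*} {f g : Perm V} {s : Set V}

theorem Equiv.Perm.IsCycleOn.congr_of_eqOn (hf : f.IsCycleOn s) (hs : s.Finite)
    (hfg : Set.EqOn f g s) :
    g.IsCycleOn s := by
  refine ⟨hf.1.congr hfg, fun x hx y hy => ?_⟩
  obtain ⟨n, rfl⟩ := hf.exists_pow_eq' hs hx hy
  refine ⟨n, ?_⟩
  clear hy
  rw [zpow_natCast]
  induction n with
  | zero => rfl
  | succ n ih =>
    rw [pow_succ', pow_succ', Perm.mul_apply, Perm.mul_apply, ih,
      hfg (hf.1.mapsTo.perm_pow n hx)]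

/-- A cycle on a finite set stays a cycle when a fixed point `z` is inserted after `a`. -/
theorem Equiv.Perm.IsCycleOn.mul_swap [DecidableEq V] (hf : f.IsCycleOn s) (hs : s.Finite)
    {a z : V} (ha : a ∈ s) (hz : z ∉ s) (hfz : f z = z) :
    (f * swap a z).IsCycleOn (insert z s) := by
  have hmem : ∀ v ∈ s, v ≠ z := fun v hv h => hz (h ▸ hv)
  have haz : (f * swap a z) a = z := by simp [hfz]
  have hza : (f * swap a z) z = f a := by simp
  have hne : ∀ v ∈ s, v ≠ a → (f * swap a z) v = f v := fun v hv hva => by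
    simp [swap_apply_of_ne_of_ne hva (hmem v hv)]
  have key : ∀ v ∈ insert z s, (f * swap a z).SameCycle a v := by
    rintro v (rfl | hv)
    · exact ⟨1, by simpa using haz⟩
    obtain ⟨n, rfl⟩ := hf.exists_pow_eq' hs ha hv
    clear hv
    induction n with
    | zero => exact SameCycle.refl _ _
    | succ n ih =>
      have hw : (f ^ n) a ∈ s := hf.1.mapsTo.perm_pow n ha
      rw [pow_succ', Perm.mul_apply]
      by_cases h : (f ^ n) a = a
      · exact ⟨2, by rw [h, zpow_two, Perm.mul_apply, haz, hza]⟩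
      · rw [← hne _ hw h, sameCycle_apply_right]
        exact ih
  have hmaps : Set.MapsTo (f * swap a z) (insert z s) (insert z s) := by
    rintro v (rfl | hv)
    · rw [hza]
      exact Or.inr (hf.1.mapsTo ha)
    · by_cases h : v = a
      · rw [h, haz]
        exact Or.inl rfl
      · rw [hne v hv h]
        exact Or.inr (hf.1.mapsTo hv)
  refine ⟨⟨hmaps, (f * swap a z).injective.injOn, ?_⟩, fun x hx y hy =>
    (key x hx).symm.trans (key y hy)⟩
  exact (((hs.insert z).injOn_iff_bijOn_of_mapsTo hmaps).1 (f * swap a z).injective.injOn).surjOn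

/-- A cycle on a finite set stays a cycle when a fixed point `z` is inserted before `a`. -/
theorem Equiv.Perm.IsCycleOn.swap_mul [DecidableEq V] (hf : f.IsCycleOn s) (hs : s.Finite)
    {a z : V} (ha : a ∈ s) (hz : z ∉ s) (hfz : f z = z) :
    (swap a z * f).IsCycleOn (insert z s) := by
  rw [← isCycleOn_inv, mul_inv_rev, swap_inv]
  exact hf.inv.mul_swap hs ha hz (Perm.inv_eq_iff_eq.2 hfz.symm)

theorem Equiv.Perm.semiconj_inv {φ : W → V} {g : Perm W} (h : Function.Semiconj φ g f) :
    Function.Semiconj φ ⇑g⁻¹ ⇑f⁻¹ := fun w => by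
  rw [Perm.eq_inv_iff_eq, ← h, ← Perm.mul_apply, mul_inv_cancel, Perm.one_apply]

theorem Equiv.Perm.IsCycleOn.of_semiconj {φ : W → V} (hφ : φ.Injective) {g : Perm W}
    (h : Function.Semiconj φ g f) {t : Set W} (ht : t.Finite) (hf : f.IsCycleOn (φ '' t)) :
    g.IsCycleOn t := by
  have hmaps : Set.MapsTo g t t := fun w hw => by
    have := hf.1.mapsTo (Set.mem_image_of_mem φ hw)
    rwa [← h, hφ.mem_set_image] at this
  refine ⟨⟨hmaps, g.injective.injOn,
      ((ht.injOn_iff_bijOn_of_mapsTo hmaps).1 g.injective.injOn).surjOn⟩, fun x hx y hy => ?_⟩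
  obtain ⟨n, hn⟩ := hf.exists_pow_eq' (ht.image φ) (Set.mem_image_of_mem φ hx)
    (Set.mem_image_of_mem φ hy)
  refine ⟨n, hφ ?_⟩
  rw [zpow_natCast, ← hn, Perm.coe_pow, Perm.coe_pow]
  exact h.iterate_right n x

theorem Equiv.Perm.IsCycleOn.mem_iff_sameCycle (hf : f.IsCycleOn s) {x v : V} (hx : x ∈ s) :
    v ∈ s ↔ f.SameCycle x v := by
  refine ⟨fun hv => hf.2 hx hv, ?_⟩
  rintro ⟨n, rfl⟩
  exact (hf.1.perm_zpow n).mapsTo hx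

theorem Equiv.Perm.cycleType_of_isCycleOn_pair [Fintype V] [DecidableEq V] {A B : Finset V}
    (hA : f.IsCycleOn A) (hB : f.IsCycleOn B) (hd : _root_.Disjoint A B) (hu : A ∪ B = Finset.univ)
    (hA2 : A.Nontrivial) (hB2 : B.Nontrivial) : f.cycleType = {A.card, B.card} := by
  obtain ⟨x, hx⟩ := hA2.nonempty
  obtain ⟨y, hy⟩ := hB2.nonempty
  have hfx : f x ≠ x := hA.apply_ne hA2 hx
  have hfy : f y ≠ y := hB.apply_ne hB2 hy
  have sx : (f.cycleOf x).support = A := by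
    ext v
    rw [mem_support_cycleOf_iff' hfx, ← hA.mem_iff_sameCycle hx, Finset.mem_coe]
  have sy : (f.cycleOf y).support = B := by
    ext v
    rw [mem_support_cycleOf_iff' hfy, ← hB.mem_iff_sameCycle hy, Finset.mem_coe]
  have hdisj : (f.cycleOf x).Disjoint (f.cycleOf y) := by
    rw [disjoint_iff_disjoint_support, sx, sy]
    exact hd
  have hprod : [f.cycleOf x, f.cycleOf y].prod = f := by
    ext v
    rw [List.prod_pair, Perm.mul_apply]
    have hv : v ∈ A ∪ B := hu ▸ Finset.mem_univ v
    rcases Finset.mem_union.1 hv with hv | hv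
    · have hv' : v ∉ (f.cycleOf y).support := sy ▸ Finset.disjoint_left.1 hd hv
      rw [notMem_support.1 hv', SameCycle.cycleOf_apply (hA.2 hx hv)]
    · have hv' : f v ∉ (f.cycleOf x).support :=
        sx ▸ Finset.disjoint_right.1 hd (hB.1.mapsTo hv)
      rw [SameCycle.cycleOf_apply (hB.2 hy hv), notMem_support.1 hv']
  rw [cycleType_eq _ hprod (by simp [isCycle_cycleOf f hfx, isCycle_cycleOf f hfy])
    (by simpa using hdisj)]
  simp only [List.map_cons, List.map_nil, Function.comp_apply, sx, sy]
  rfl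

end CycleOn

/-- `σ` and `π` are full cycles on the disjoint union `A ∪ B`, and their commutator
`σ⁻¹ π⁻¹ σ π` is a cycle on `A` and on `B`. -/
structure IsCommutatorPair {V : Type*} [DecidableEq V] (σ π : Perm V) (A B : Finset V) :
    Prop where
  disjoint : _root_.Disjoint A B
  left_isCycleOn : σ.IsCycleOn ↑(A ∪ B)
  right_isCycleOn : π.IsCycleOn ↑(A ∪ B)
  left_apply : ∀ v ∉ A ∪ B, σ v = v
  right_apply : ∀ v ∉ A ∪ B, π v = v
  commutator_isCycleOn_fst : (σ⁻¹ * π⁻¹ * σ * π).IsCycleOn ↑A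
  commutator_isCycleOn_snd : (σ⁻¹ * π⁻¹ * σ * π).IsCycleOn ↑B

namespace IsCommutatorPair

variable {V : Type*} [DecidableEq V] {σ π : Perm V} {A B : Finset V}

theorem symm (h : IsCommutatorPair σ π A B) : IsCommutatorPair σ π B A where
  disjoint := h.disjoint.symm
  left_isCycleOn := Finset.union_comm A B ▸ h.left_isCycleOn
  right_isCycleOn := Finset.union_comm A B ▸ h.right_isCycleOn
  left_apply := Finset.union_comm A B ▸ h.left_apply
  right_apply := Finset.union_comm A B ▸ h.right_apply
  commutator_isCycleOn_fst := h.commutator_isCycleOn_snd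
  commutator_isCycleOn_snd := h.commutator_isCycleOn_fst

end IsCommutatorPair

section Detour

variable {V : Type*} [DecidableEq V]

/-- For `a, b, c, d` fixed by `f`, the permutation `detour f x a b c d` replaces the arrow
`x ↦ f x` by the path `x, a, b, c, d, f x`. -/
def detour (f : Perm V) (x a b c d : V) : Perm V :=
  f * swap x a * swap a b * swap b c * swap c d

variable {f : Perm V} {x a b c d : V}

theorem detour_apply (hne : [x, a, b, c, d].Nodup) :
    detour f x a b c d x = f a ∧ detour f x a b c d a = f b ∧ detour f x a b c d b = f c ∧
      detour f x a b c d c = f d ∧ detour f x a b c d d = f x := by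
  simp only [List.nodup_cons, List.mem_cons, not_or, List.not_mem_nil] at hne
  obtain ⟨⟨hxa, hxb, hxc, hxd, -⟩, ⟨hab, hac, had, -⟩, ⟨hbc, hbd, -⟩, ⟨hcd, -⟩, -⟩ := hne
  have := Ne.symm hxa
  have := Ne.symm hxb
  have := Ne.symm hxc
  have := Ne.symm hxd
  have := Ne.symm hab
  have := Ne.symm hac
  have := Ne.symm had
  have := Ne.symm hbc
  have := Ne.symm hbd
  have := Ne.symm hcd
  refine ⟨?_, ?_, ?_, ?_, ?_⟩ <;> simp [detour, swap_apply_of_ne_of_ne, *]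

theorem detour_apply_of_notMem {v : V} (hv : v ∉ [x, a, b, c, d]) :
    detour f x a b c d v = f v := by
  simp only [List.mem_cons, not_or, List.not_mem_nil] at hv
  simp [detour, swap_apply_of_ne_of_ne, hv]

theorem Equiv.Perm.IsCycleOn.detour {s : Set V} (hf : f.IsCycleOn s) (hs : s.Finite) (hx : x ∈ s)
    (hne : [x, a, b, c, d].Nodup) (has : ∀ z ∈ [a, b, c, d], z ∉ s)
    (hfix : ∀ z ∈ [a, b, c, d], f z = z) :
    (detour f x a b c d).IsCycleOn (insert d (insert c (insert b (insert a s)))) := by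
  simp only [List.nodup_cons, List.mem_cons, not_or, List.not_mem_nil] at hne
  obtain ⟨⟨hxa, hxb, hxc, hxd, -⟩, ⟨hab, hac, had, -⟩, ⟨hbc, hbd, -⟩, ⟨hcd, -⟩, -⟩ := hne
  simp only [List.forall_mem_cons] at has hfix
  obtain ⟨ha, hb, hc, hd, -⟩ := has
  obtain ⟨fa, fb, fc, fd, -⟩ := hfix
  have h1 := hf.mul_swap hs hx ha fa
  have h2 := h1.mul_swap (z := b) (hs.insert a) (a := a) (by simp)
    (by simp [Ne.symm hab, hb]) (by simp [swap_apply_of_ne_of_ne (Ne.symm hxb) (Ne.symm hab), fb])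
  have h3 := h2.mul_swap (z := c) ((hs.insert a).insert b) (a := b) (by simp)
    (by simp [Ne.symm hac, Ne.symm hbc, hc])
    (by simp [swap_apply_of_ne_of_ne, Ne.symm hxc, Ne.symm hac, Ne.symm hbc, fc])
  exact h3.mul_swap (z := d) (((hs.insert a).insert b).insert c) (a := c) (by simp)
    (by simp [Ne.symm had, Ne.symm hbd, Ne.symm hcd, hd])
    (by simp [swap_apply_of_ne_of_ne, Ne.symm hxd, Ne.symm had, Ne.symm hbd, Ne.symm hcd, fd])

/-- Replacing a common arrow `x ↦ σ x = π x` by the paths `x, a, b, c, d, σ x` in `σ` and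
`x, a, c, d, b, π x` in `π` inserts the points `d` and `c, a, b` before and after `x` in the
commutator. -/
theorem commutator_detour {σ π : Perm V} (hx : σ x = π x) (hσx : σ x ≠ x)
    (hne : [x, a, b, c, d].Nodup)
    (hσ : ∀ z ∈ [a, b, c, d], σ z = z) (hπ : ∀ z ∈ [a, b, c, d], π z = z) :
    (detour σ x a b c d)⁻¹ * (detour π x a c d b)⁻¹ * detour σ x a b c d * detour π x a c d b =
      swap x d * (σ⁻¹ * π⁻¹ * σ * π) * swap x c * swap c a * swap a b := by
  have hne' : [x, a, c, d, b].Nodup := by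
    refine (List.Perm.nodup_iff ?_).1 hne
    exact ((List.perm_append_comm (l₁ := [b]) (l₂ := [c, d])).cons a).cons x
  obtain ⟨Sx, Sa, Sb, Sc, Sd⟩ := detour_apply (f := σ) hne
  obtain ⟨Px, Pa, Pc, Pd, Pb⟩ := detour_apply (f := π) hne'
  have Sv := fun v => detour_apply_of_notMem (f := σ) (x := x) (a := a) (b := b) (c := c) (d := d)
    (v := v)
  have Pv : ∀ v, v ∉ [x, a, b, c, d] → _ := fun v hv =>
    detour_apply_of_notMem (f := π) (x := x) (a := a) (b := c) (c := d) (d := b)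
    (v := v) (by simp at hv ⊢; tauto)
  generalize detour σ x a b c d = S at *
  generalize detour π x a c d b = P at *
  generalize hα : σ⁻¹ * π⁻¹ * σ * π = α
  have hα' : ∀ v, σ (π v) = π (σ (α v)) := fun v => by simp [← hα]
  have goal : S * P = P * S * (swap x d * α * swap x c * swap c a * swap a b) := by
    simp only [List.forall_mem_cons] at hσ hπ
    simp only [List.nodup_cons, List.mem_cons, not_or, List.not_mem_nil] at hne Sv Pv
    obtain ⟨σa, σb, σc, σd, -⟩ := hσ
    obtain ⟨πa, πb, πc, πd, -⟩ := hπ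
    obtain ⟨⟨hxa, hxb, hxc, hxd, -⟩, ⟨hab, hac, had, -⟩, ⟨hbc, hbd, -⟩, ⟨hcd, -⟩, -⟩ := hne
    have hπx : π x ≠ x := hx ▸ hσx
    have fix : ∀ z, σ z = z → π z = z → α z = z := fun z h1 h2 => by
      apply σ.injective; apply π.injective; rw [← hα', h2, h1, h2]
    have αa := fix a σa πa
    have αb := fix b σb πb
    have αc := fix c σc πc
    have αd := fix d σd πd
    have ne_of_fix : ∀ f : Perm V, ∀ z v, f z = z → v ≠ z → f v ≠ z := fun f z v hz hv h =>
      hv (f.injective (h.trans hz.symm))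
    have hax := Ne.symm hxa
    have hbx := Ne.symm hxb
    have hcx := Ne.symm hxc
    have hdx := Ne.symm hxd
    have hba := Ne.symm hab
    have hca := Ne.symm hac
    have hda := Ne.symm had
    have hcb := Ne.symm hbc
    have hdb := Ne.symm hbd
    have hdc := Ne.symm hcd
    have PS : ∀ w, w ≠ x → w ≠ a → w ≠ b → w ≠ c → w ≠ d → P (S w) =
        if σ w = x then a else π (σ w) := by
      intro w hwx hwa hwb hwc hwd
      rw [Sv w (by simp [*])]
      split_ifs with h
      · rw [h, Px, πa]
      · exact Pv _ (by simp [*])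
    have key : ∀ v, v ≠ a → v ≠ b → v ≠ c → v ≠ d →
        S (π v) = P (S (swap x d (α v))) := by
      intro v hva hvb hvc hvd
      have hπv : π v = x ↔ σ (α v) = x := by
        rw [← π.injective.eq_iff (a := σ (α v)), ← hα', ← hx, σ.injective.eq_iff]
      have hS : S (π v) = if π v = x then a else σ (π v) := by
        split_ifs with h
        · rw [h, Sx, σa]
        · exact Sv _ ⟨h, ne_of_fix _ _ _ πa hva, ne_of_fix _ _ _ πb hvb, ne_of_fix _ _ _ πc hvc,
            ne_of_fix _ _ _ πd hvd, id⟩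
      by_cases h : α v = x
      · rw [h] at hπv
        rw [h, swap_apply_left, Sd, hS, if_neg (by rwa [hπv]), hα', h]
        exact (Pv _ (by simp [*])).symm
      · rw [swap_apply_of_ne_of_ne h (by simp [*]),
          PS _ h (by simp [*]) (by simp [*]) (by simp [*])
            (by simp [*]), hS, hα']
        simp only [hπv]
    clear hα' Sv PS
    ext v
    simp only [Perm.mul_apply]
    by_cases hvx : v = x
    · subst hvx
      simp [swap_apply_of_ne_of_ne, *]
    by_cases hva : v = a
    · subst hva
      simp [swap_apply_of_ne_of_ne, *]
    by_cases hvb : v = b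
    · subst hvb
      simp [*]
    by_cases hvc : v = c
    · subst hvc
      simp [swap_apply_of_ne_of_ne, *]
    by_cases hvd : v = d
    · subst hvd
      simp [swap_apply_of_ne_of_ne, *]
    simp [swap_apply_of_ne_of_ne, *]
  rw [mul_assoc _ S, goal]
  group

end Detour

namespace IsCommutatorPair

variable {V : Type*} [DecidableEq V] {σ π : Perm V} {A B : Finset V}

theorem exists_insert_four [Infinite V] (h : IsCommutatorPair σ π A B) (hB : B.Nonempty) {x : V}
    (hxA : x ∈ A) (hx : σ x = π x) :
    ∃ (σ' π' : Perm V) (A' : Finset V), IsCommutatorPair σ' π' A' B ∧ A'.card = A.card + 4 ∧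
      x ∈ A' ∧ σ' x = π' x ∧ ∀ y ∈ B, σ y = π y → σ' y = π' y := by
  obtain ⟨a, ha⟩ := Infinite.exists_notMem_finset (A ∪ B)
  obtain ⟨b, hb⟩ := Infinite.exists_notMem_finset (insert a (A ∪ B))
  obtain ⟨c, hc⟩ := Infinite.exists_notMem_finset (insert b (insert a (A ∪ B)))
  obtain ⟨d, hd⟩ := Infinite.exists_notMem_finset (insert c (insert b (insert a (A ∪ B))))
  simp only [Finset.mem_insert, Finset.mem_union, not_or] at ha hb hc hd
  obtain ⟨haA, haB⟩ := ha
  obtain ⟨hba, hbA, hbB⟩ := hb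
  obtain ⟨hcb, hca, hcA, hcB⟩ := hc
  obtain ⟨hdc, hdb, hda, hdA, hdB⟩ := hd
  have ne_of_mem : ∀ z, z ∉ A → x ≠ z := fun z hz h => hz (h ▸ hxA)
  have hne : [x, a, b, c, d].Nodup := by
    simp [*, Ne.symm hba, Ne.symm hca, Ne.symm hcb, Ne.symm hda, Ne.symm hdb,
      Ne.symm hdc]
  have hperm : [a, b, c, d].Perm [a, c, d, b] :=
    (List.perm_append_comm (l₁ := [b]) (l₂ := [c, d])).cons a
  have hne' : [x, a, c, d, b].Nodup := (hperm.cons x).nodup_iff.1 hne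
  have hnotMem : ∀ z ∈ [a, b, c, d], z ∉ A ∪ B := by simp [*]
  have hσ : ∀ z ∈ [a, b, c, d], σ z = z := fun z hz => h.left_apply z (hnotMem z hz)
  have hπ : ∀ z ∈ [a, b, c, d], π z = z := fun z hz => h.right_apply z (hnotMem z hz)
  have hxAB : x ∈ A ∪ B := Finset.mem_union_left _ hxA
  have hσx : σ x ≠ x := by
    refine h.left_isCycleOn.apply_ne ?_ hxAB
    obtain ⟨y, hy⟩ := hB
    exact ⟨x, hxAB, y, Finset.mem_union_right _ hy,
      fun e => Finset.disjoint_left.1 h.disjoint hxA (e ▸ hy)⟩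
  have hcomm := commutator_detour hx hσx hne hσ hπ
  have hcfix : ∀ z ∈ [a, b, c, d], (σ⁻¹ * π⁻¹ * σ * π) z = z := fun z hz => by
    simp only [Perm.mul_apply, hπ z hz, hσ z hz, Perm.inv_eq_iff_eq]
  have hBne : ∀ v ∈ B, v ∉ [x, a, b, c, d] := by
    intro v hv hv'
    rcases List.mem_cons.1 hv' with rfl | hv'
    · exact Finset.disjoint_left.1 h.disjoint hxA hv
    · exact hnotMem v hv' (Finset.mem_union_right _ hv)
  refine ⟨detour σ x a b c d, detour π x a c d b, insert d (insert c (insert b (insert a A))),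
    ⟨?_, ?_, ?_, ?_, ?_, ?_, ?_⟩, ?_, ?_, ?_, ?_⟩
  · simp [*, h.disjoint]
  · convert! h.left_isCycleOn.detour (Finset.finite_toSet _) hxAB hne hnotMem hσ using 1
    simp only [Finset.insert_union, Finset.coe_insert]
  · convert! h.right_isCycleOn.detour (Finset.finite_toSet _) hxAB hne'
      (fun z hz => hnotMem z (hperm.mem_iff.2 hz)) (fun z hz => hπ z (hperm.mem_iff.2 hz)) using 1
    simp only [Finset.insert_union, Finset.coe_insert]
    rw [Set.insert_comm c b, Set.insert_comm d b]
  · intro v hv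
    simp only [Finset.insert_union, Finset.mem_insert, not_or] at hv
    rw [detour_apply_of_notMem, h.left_apply v hv.2.2.2.2]
    have : v ≠ x := fun e => hv.2.2.2.2 (e ▸ hxAB)
    simp [*]
  · intro v hv
    simp only [Finset.insert_union, Finset.mem_insert, not_or] at hv
    rw [detour_apply_of_notMem, h.right_apply v hv.2.2.2.2]
    have : v ≠ x := fun e => hv.2.2.2.2 (e ▸ hxAB)
    simp [*]
  · rw [hcomm]
    have hfin := A.finite_toSet
    have h1 := h.commutator_isCycleOn_fst.swap_mul hfin hxA hdA (hcfix d (by simp))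
    have h2 := h1.mul_swap (z := c) (hfin.insert d) (a := x) (by simp [hxA])
      (by simp [*, Ne.symm hdc])
      (by
        rw [Perm.mul_apply, hcfix c (by simp), swap_apply_of_ne_of_ne (Ne.symm (ne_of_mem c hcA))
          (Ne.symm hdc)])
    have h3 := h2.mul_swap (z := a) ((hfin.insert d).insert c) (a := c) (by simp)
      (by simp [*, Ne.symm hda, Ne.symm hca])
      (by
        rw [Perm.mul_apply, Perm.mul_apply, swap_apply_of_ne_of_ne (Ne.symm (ne_of_mem a haA))
          (Ne.symm hca), hcfix a (by simp), swap_apply_of_ne_of_ne (Ne.symm (ne_of_mem a haA))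
          (Ne.symm hda)])
    have h4 := h3.mul_swap (z := b) (((hfin.insert d).insert c).insert a) (a := a) (by simp)
      (by simp [*, Ne.symm hdb, Ne.symm hcb])
      (by
        rw [Perm.mul_apply, Perm.mul_apply, Perm.mul_apply,
          swap_apply_of_ne_of_ne (Ne.symm hcb) hba,
          swap_apply_of_ne_of_ne (Ne.symm (ne_of_mem b hbA)) (Ne.symm hcb), hcfix b (by simp),
          swap_apply_of_ne_of_ne (Ne.symm (ne_of_mem b hbA)) (Ne.symm hdb)])
    convert! h4 using 1
    simp only [Finset.coe_insert]
    rw [Set.insert_comm d c, Set.insert_comm d b, Set.insert_comm d a, Set.insert_comm c b,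
      Set.insert_comm c a]
  · refine h.commutator_isCycleOn_snd.congr_of_eqOn B.finite_toSet fun v hv => ?_
    have hv' := hBne v hv
    have hv'' := hBne _ (h.commutator_isCycleOn_snd.1.mapsTo hv)
    simp only [List.mem_cons, not_or, List.not_mem_nil] at hv' hv''
    rw [hcomm]
    generalize σ⁻¹ * π⁻¹ * σ * π = α at hv'' ⊢
    simp [swap_apply_of_ne_of_ne, hv', hv'']
  · simp [*]
  · simp [hxA]
  · rw [(detour_apply hne).1, (detour_apply hne').1, hσ a (by simp), hπ a (by simp)]
  · intro y hy hyσ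
    rw [detour_apply_of_notMem (hBne y hy), detour_apply_of_notMem, hyσ]
    exact fun hy' => hBne y hy ((hperm.cons x).mem_iff.2 hy')

/-- A commutator pair with a common arrow starting in `A` can be relabelled so that the left
permutation is `finRotate` and the common arrow is `0 ↦ 1`. -/
theorem exists_perm_fin (h : IsCommutatorPair σ π A B) {x : V} (hxA : x ∈ A) (hx : σ x = π x)
    (hA : A.Nontrivial) (hB : B.Nontrivial) {n : ℕ} (hn : A.card + B.card = n) (h0 : 0 < n)
    (h1 : 1 < n) :
    ∃ τ : Perm (Fin n), τ.IsCycle ∧ τ.support.card = n ∧ τ ⟨0, h0⟩ = ⟨1, h1⟩ ∧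
      ((finRotate n)⁻¹ * τ⁻¹ * finRotate n * τ).cycleType = {A.card, B.card} := by
  have hcard : (A ∪ B).card = n := by rw [Finset.card_union_of_disjoint h.disjoint, hn]
  have hxAB : x ∈ A ∪ B := Finset.mem_union_left _ hxA
  let φ : Fin n → V := fun i => (σ ^ (i : ℕ)) x
  have hφ : φ.Injective := fun i j hij => by
    have := (h.left_isCycleOn.pow_apply_eq_pow_apply hxAB).1 hij
    rw [hcard] at this
    exact Fin.ext (Nat.ModEq.eq_of_lt_of_lt this i.2 j.2)
  have hφmem : ∀ i, φ i ∈ A ∪ B := fun i => h.left_isCycleOn.1.mapsTo.perm_pow i hxAB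
  have hφsurj : ∀ v ∈ A ∪ B, ∃ i, φ i = v := fun v hv => by
    obtain ⟨m, hm, rfl⟩ := h.left_isCycleOn.exists_pow_eq hxAB hv
    exact ⟨⟨m, hcard ▸ hm⟩, rfl⟩
  have hrot : Function.Semiconj φ (finRotate n) σ := fun i => by
    obtain ⟨n, rfl⟩ := Nat.exists_eq_succ_of_ne_zero h0.ne'
    by_cases hi : i = Fin.last n
    · have := h.left_isCycleOn.pow_card_apply hxAB
      rw [hcard, pow_succ', Perm.mul_apply] at this
      simpa [φ, hi] using this.symm
    · simp only [φ, coe_finRotate_of_ne_last hi, pow_succ', Perm.mul_apply]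
  let e : Fin n ≃ {v // v ∈ A ∪ B} := Equiv.ofBijective (fun i => ⟨φ i, hφmem i⟩)
    ⟨fun i j hij => hφ (congrArg Subtype.val hij), fun v => by
      obtain ⟨i, hi⟩ := hφsurj v v.2
      exact ⟨i, Subtype.ext hi⟩⟩
  let τ : Perm (Fin n) := e.symm.permCongr
    (π.subtypePerm fun v => h.right_isCycleOn.apply_mem_iff)
  have hτ : Function.Semiconj φ τ π := fun i => by
    have : e (τ i) = π.subtypePerm (fun v => h.right_isCycleOn.apply_mem_iff) (e i) := by
      simp [τ]
    exact congrArg Subtype.val this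
  have himage : ∀ C ⊆ A ∪ B, φ '' ↑(Finset.univ.filter (φ · ∈ C)) = C := fun C hC => by
    ext v
    constructor
    · rintro ⟨i, hi, rfl⟩
      simpa using hi
    · intro hv
      obtain ⟨i, rfl⟩ := hφsurj v (hC hv)
      exact ⟨i, by simpa using hv, rfl⟩
  have hcardfilter : ∀ C ⊆ A ∪ B, (Finset.univ.filter (φ · ∈ C)).card = C.card := fun C hC => by
    rw [← Set.ncard_coe_finset, ← Set.ncard_image_of_injective _ hφ, himage C hC,
      Set.ncard_coe_finset]
  have hτuniv : τ.IsCycleOn Set.univ := by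
    refine .of_semiconj hφ hτ Set.finite_univ ?_
    convert h.right_isCycleOn
    ext v
    simp only [Set.image_univ, Set.mem_range, Finset.mem_coe]
    exact ⟨by rintro ⟨i, rfl⟩; exact hφmem i, hφsurj v⟩
  have hnt : (Set.univ : Set (Fin n)).Nontrivial :=
    ⟨⟨0, h0⟩, trivial, ⟨1, h1⟩, trivial, by simp⟩
  have hτne : ∀ i, τ i ≠ i := fun i => hτuniv.apply_ne hnt trivial
  have hcomm : Function.Semiconj φ ⇑((finRotate n)⁻¹ * τ⁻¹ * finRotate n * τ)
      ⇑(σ⁻¹ * π⁻¹ * σ * π) :=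
    (((semiconj_inv hrot).comp_right (semiconj_inv hτ)).comp_right hrot).comp_right hτ
  refine ⟨τ, ?_, ?_, ?_, ?_⟩
  · exact isCycle_iff_exists_isCycleOn.2 ⟨_, hnt, hτuniv, fun _ _ => trivial⟩
  · rw [show τ.support = Finset.univ by ext i; simp [hτne]]
    simp
  · apply hφ
    rw [hτ]
    simp [φ, hx]
  · rw [← hcardfilter A Finset.subset_union_left, ← hcardfilter B Finset.subset_union_right]
    apply cycleType_of_isCycleOn_pair
    · refine .of_semiconj hφ hcomm (Finset.finite_toSet _) ?_
      rw [himage A Finset.subset_union_left]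
      exact h.commutator_isCycleOn_fst
    · refine .of_semiconj hφ hcomm (Finset.finite_toSet _) ?_
      rw [himage B Finset.subset_union_right]
      exact h.commutator_isCycleOn_snd
    · rw [Finset.disjoint_filter]
      exact fun i _ hi => Finset.disjoint_left.1 h.disjoint hi
    · ext i
      simpa using hφmem i
    · rw [← Finset.one_lt_card_iff_nontrivial, hcardfilter A Finset.subset_union_left]
      exact Finset.one_lt_card_iff_nontrivial.2 hA
    · rw [← Finset.one_lt_card_iff_nontrivial, hcardfilter B Finset.subset_union_right]
      exact Finset.one_lt_card_iff_nontrivial.2 hB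

theorem exists_insert_four_mul {V : Type*} [DecidableEq V] [Infinite V] {σ π : Perm V}
    {A B : Finset V} (h : IsCommutatorPair σ π A B) (hB : B.Nonempty) {x : V} (hxA : x ∈ A)
    (hx : σ x = π x) (i : ℕ) :
    ∃ (σ' π' : Perm V) (A' : Finset V), IsCommutatorPair σ' π' A' B ∧ A'.card = A.card + 4 * i ∧
      x ∈ A' ∧ σ' x = π' x ∧ ∀ y ∈ B, σ y = π y → σ' y = π' y := by
  induction i with
  | zero => exact ⟨σ, π, A, h, rfl, hxA, hx, fun _ _ => id⟩
  | succ i ih =>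
    obtain ⟨σ₁, π₁, A₁, h₁, hA₁, hxA₁, hx₁, hB₁⟩ := ih
    obtain ⟨σ₂, π₂, A₂, h₂, hA₂, hxA₂, hx₂, hB₂⟩ := h₁.exists_insert_four hB hxA₁ hx₁
    exact ⟨σ₂, π₂, A₂, h₂, by omega, hxA₂, hx₂, fun y hy hyσ => hB₂ y hy (hB₁ y hy hyσ)⟩

theorem of_formPerm {V : Type*} [DecidableEq V] {l m s t : List V} (hl : l.Nodup)
    (hm : m.Perm l) (hst : (s ++ t).Perm l)
    (hs : ∀ v ∈ s, l.formPerm (m.formPerm v) = m.formPerm (l.formPerm (s.formPerm v)))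
    (ht : ∀ v ∈ t, l.formPerm (m.formPerm v) = m.formPerm (l.formPerm (t.formPerm v))) :
    IsCommutatorPair l.formPerm m.formPerm s.toFinset t.toFinset := by
  have hst' := hst.nodup_iff.2 hl
  have hunion : s.toFinset ∪ t.toFinset = l.toFinset := by
    rw [← List.toFinset_append, List.toFinset_eq_of_perm _ _ hst]
  have hcycle : ∀ r : List V, r.Nodup → r.formPerm.IsCycleOn ↑r.toFinset := fun r hr => by
    simpa using hr.isCycleOn_formPerm
  have hcomm : ∀ r : List V, r.Nodup →
      (∀ v ∈ r, l.formPerm (m.formPerm v) = m.formPerm (l.formPerm (r.formPerm v))) →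
      (l.formPerm⁻¹ * m.formPerm⁻¹ * l.formPerm * m.formPerm).IsCycleOn ↑r.toFinset :=
    fun r hr hv => (hcycle r hr).congr_of_eqOn (Finset.finite_toSet _) fun v hvr => by
      simp [hv v (by simpa using hvr)]
  refine ⟨?_, ?_, ?_, ?_, ?_, hcomm s (List.nodup_append.1 hst').1 hs,
    hcomm t (List.nodup_append.1 hst').2.1 ht⟩
  · exact List.disjoint_toFinset_iff_disjoint.2 (List.disjoint_of_nodup_append hst')
  · rw [hunion]
    exact hcycle l hl
  · rw [hunion, ← List.toFinset_eq_of_perm _ _ hm]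
    exact hcycle m (hm.nodup_iff.2 hl)
  · rw [hunion]
    exact fun v hv => List.formPerm_apply_of_notMem (by simpa using hv)
  · rw [hunion, ← List.toFinset_eq_of_perm _ _ hm]
    exact fun v hv => List.formPerm_apply_of_notMem (by simpa using hv)

/-- There is a commutator pair on `ℕ` with a common arrow and with cycles of lengths `m, n`. -/
def ExistsOfCard (m n : ℕ) : Prop :=
  ∃ (σ π : Perm ℕ) (A B : Finset ℕ) (x : ℕ), IsCommutatorPair σ π A B ∧ A.card = m ∧ B.card = n ∧
    x ∈ A ∪ B ∧ σ x = π x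

theorem ExistsOfCard.symm {m n : ℕ} (h : ExistsOfCard m n) : ExistsOfCard n m := by
  obtain ⟨σ, π, A, B, x, h, hA, hB, hx, hσ⟩ := h
  exact ⟨σ, π, B, A, x, h.symm, hB, hA, Finset.union_comm A B ▸ hx, hσ⟩

theorem existsOfCard_add_four_mul {σ π : Perm ℕ} {A B : Finset ℕ} (h : IsCommutatorPair σ π A B)
    {x y : ℕ} (hxA : x ∈ A) (hx : σ x = π x) (hyB : y ∈ B) (hy : σ y = π y) (i j : ℕ) :
    ExistsOfCard (A.card + 4 * i) (B.card + 4 * j) := by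
  obtain ⟨σ₁, π₁, A₁, h₁, hA₁, hxA₁, hx₁, hB₁⟩ := h.exists_insert_four_mul ⟨y, hyB⟩ hxA hx i
  obtain ⟨σ₂, π₂, B₂, h₂, hB₂, -, -, hA₂⟩ :=
    h₁.symm.exists_insert_four_mul ⟨x, hxA₁⟩ hyB (hB₁ y hyB hy) j
  exact ⟨σ₂, π₂, A₁, B₂, x, h₂.symm, hA₁, hB₂, Finset.mem_union_left _ hxA₁, hA₂ x hxA₁ hx₁⟩

theorem existsOfCard_two_four : ExistsOfCard 2 4 :=
  ⟨_, _, _, _, 0, of_formPerm (l := [0, 1, 2, 3, 4, 5]) (m := [0, 1, 3, 5, 4, 2]) (s := [2, 5])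
    (t := [0, 3, 1, 4]) (by decide) (by decide) (by decide) (by decide) (by decide), rfl, rfl,
    by decide, by decide⟩

theorem existsOfCard_of_even (i j : ℕ) : ExistsOfCard (4 + 4 * i) (4 + 4 * j) :=
  existsOfCard_add_four_mul (x := 0) (y := 5)
    (of_formPerm (l := [0, 1, 2, 3, 4, 5, 6, 7]) (m := [0, 1, 3, 5, 6, 4, 7, 2])
      (s := [0, 6, 2, 7]) (t := [1, 5, 3, 4]) (by decide) (by decide) (by decide) (by decide)
      (by decide)) (by decide) (by decide) (by decide) (by decide) i j

theorem existsOfCard_of_odd (i j : ℕ) : ExistsOfCard (2 + 4 * i) (6 + 4 * j) :=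
  existsOfCard_add_four_mul (x := 4) (y := 0)
    (of_formPerm (l := [0, 1, 2, 3, 4, 5, 6, 7]) (m := [0, 1, 3, 6, 2, 7, 4, 5])
      (s := [2, 4]) (t := [0, 5, 7, 3, 1, 6]) (by decide) (by decide) (by decide) (by decide)
      (by decide)) (by decide) (by decide) (by decide) (by decide) i j

theorem existsOfCard_four_six (i j : ℕ) : ExistsOfCard (4 + 4 * i) (6 + 4 * j) :=
  existsOfCard_add_four_mul (x := 5) (y := 0)
    (of_formPerm (l := [0, 1, 2, 3, 4, 5, 6, 7, 8, 9]) (m := [0, 1, 3, 2, 5, 6, 4, 8, 9, 7])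
      (s := [1, 5, 8, 6]) (t := [0, 2, 4, 7, 9, 3]) (by decide) (by decide) (by decide)
      (by decide) (by decide)) (by decide) (by decide) (by decide) (by decide) i j

theorem existsOfCard_two_eight (i j : ℕ) : ExistsOfCard (2 + 4 * i) (8 + 4 * j) :=
  existsOfCard_add_four_mul (x := 6) (y := 0)
    (of_formPerm (l := [0, 1, 2, 3, 4, 5, 6, 7, 8, 9]) (m := [0, 1, 3, 2, 5, 8, 4, 9, 6, 7])
      (s := [4, 6]) (t := [0, 2, 8, 1, 7, 9, 5, 3]) (by decide) (by decide) (by decide)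
      (by decide) (by decide)) (by decide) (by decide) (by decide) (by decide) i j

theorem existsOfCard_of_odd_of_even {k l : ℕ} (hk : Odd k) (hl : Even l) (hl0 : 1 ≤ l) :
    ExistsOfCard (2 * k) (2 * l) := by
  obtain ⟨i, rfl⟩ := hk
  obtain ⟨j, rfl⟩ := hl
  match i, j with
  | 0, 1 => exact existsOfCard_two_four
  | i + 1, 1 =>
    convert (existsOfCard_four_six 0 i).symm using 1
    omega
  | i, j + 2 => convert existsOfCard_two_eight i j using 1 <;> omega

theorem existsOfCard_two_mul {k l : ℕ} (hk : 1 ≤ k) (hl : 1 ≤ l) (hkl : (k, l) ≠ (1, 1)) :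
    ExistsOfCard (2 * k) (2 * l) := by
  rcases Nat.even_or_odd k with hk' | hk' <;> rcases Nat.even_or_odd l with hl' | hl'
  · obtain ⟨i, rfl⟩ := hk'
    obtain ⟨j, rfl⟩ := hl'
    convert existsOfCard_of_even (i - 1) (j - 1) using 1 <;> omega
  · exact (existsOfCard_of_odd_of_even hl' hk' hk).symm
  · exact existsOfCard_of_odd_of_even hk' hl' hl
  · obtain ⟨i, rfl⟩ := hk'
    obtain ⟨j, rfl⟩ := hl'
    obtain rfl | hj := Nat.eq_zero_or_pos j
    · have : i ≠ 0 := by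
        rintro rfl
        exact hkl rfl
      convert (existsOfCard_of_odd 0 (i - 1)).symm using 1 <;> omega
    · convert existsOfCard_of_odd i (j - 1) using 1 <;> omega

end IsCommutatorPair

/-- For all `k, l ≥ 1` with `(k, l) ≠ (1, 1)`, there is a `(2k+2l)`-cycle `π`
with `π(1) = 2` (0-indexed: `0 ↦ 1`) such that `[σ_{2k+2l}, π]` has cycle
type `(2k, 2l)`. -/
theorem exists_commutator_cycleType_even_pair (k l : ℕ) (hk : 1 ≤ k)
    (hl : 1 ≤ l) (hkl : (k, l) ≠ (1, 1)) :
    ∃ π : Equiv.Perm (Fin (2 * k + 2 * l)),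
      π.IsCycle ∧ π.support.card = 2 * k + 2 * l ∧
      π ⟨0, by omega⟩ = ⟨1, by omega⟩ ∧
      ((finRotate (2 * k + 2 * l))⁻¹ * π⁻¹ *
          finRotate (2 * k + 2 * l) * π).cycleType
        = ({2 * k, 2 * l} : Multiset ℕ) := by
  obtain ⟨σ, π, A, B, x, h, hA, hB, hxAB, hx⟩ :=
    IsCommutatorPair.existsOfCard_two_mul hk hl hkl
  have hA' : A.Nontrivial := Finset.one_lt_card_iff_nontrivial.1 (by omega)
  have hB' : B.Nontrivial := Finset.one_lt_card_iff_nontrivial.1 (by omega)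
  rcases Finset.mem_union.1 hxAB with hxA | hxB
  · have := h.exists_perm_fin hxA hx hA' hB' (n := 2 * k + 2 * l) (by omega) (by omega) (by omega)
    rwa [hA, hB] at this
  · have := h.symm.exists_perm_fin hxB hx hB' hA' (n := 2 * k + 2 * l) (by omega) (by omega)
      (by omega)
    rwa [hA, hB, Multiset.pair_comm] at this
end

section
/- In S₅, no permutation of cycle type (1,2,2) (a product of two disjoint transpositions) is a commutator of two 5-cycles; hence the commutator map on pairs of 5-cycles is not surjective onto A₅. -/
/-- The commutator of the rotation of `Fin 5` with an element of order dividing `5` is never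
an involution. -/
lemma finRotate_commutator_eq_one_of_sq_eq_one :
    ∀ π : Equiv.Perm (Fin 5), π ^ 5 = 1 →
      ((finRotate 5)⁻¹ * π⁻¹ * finRotate 5 * π) ^ 2 = 1 →
        (finRotate 5)⁻¹ * π⁻¹ * finRotate 5 * π = 1 := by
  decide +kernel

/-- The commutator of two `5`-cycles in `S₅` is never an involution. -/
lemma five_cycles_commutator_eq_one_of_sq_eq_one {τ π : Equiv.Perm (Fin 5)}
    (hτ : τ.IsCycle) (hτ_card : τ.support.card = 5)
    (hπ : π.IsCycle) (hπ_card : π.support.card = 5)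
    (h : (τ⁻¹ * π⁻¹ * τ * π) ^ 2 = 1) : τ⁻¹ * π⁻¹ * τ * π = 1 := by
  have hconj : IsConj (finRotate 5) τ :=
    isCycle_finRotate.isConj hτ (by rw [hτ_card, support_finRotate]; rfl)
  obtain ⟨g, rfl⟩ := isConj_iff.mp hconj
  have hπ_pow : π ^ 5 = 1 :=
    orderOf_dvd_iff_pow_eq_one.mp (hπ.orderOf.trans hπ_card).dvd
  have hcomm : (g * finRotate 5 * g⁻¹)⁻¹ * π⁻¹ * (g * finRotate 5 * g⁻¹) * π =
      g * ((finRotate 5)⁻¹ * (g⁻¹ * π * g)⁻¹ * finRotate 5 * (g⁻¹ * π * g)) * g⁻¹ := by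
    group
  have hpow : (g⁻¹ * π * g) ^ 5 = 1 := by
    simpa [hπ_pow] using conj_pow (i := 5) (a := g⁻¹) (b := π)
  rw [hcomm, conj_pow, conj_eq_one_iff] at h
  rw [hcomm, conj_eq_one_iff]
  exact finRotate_commutator_eq_one_of_sq_eq_one _ hpow h

/-- In `S₅`, no permutation of cycle type `(1,2,2)` (a product of two disjoint
transpositions; Mathlib cycle type `{2,2}`) is a commutator of two 5-cycles;
hence the commutator map on pairs of 5-cycles is not surjective onto `A₅`. -/
theorem five_cycles_commutator_not_surjective :
    (∀ ρ : Equiv.Perm (Fin 5), ρ.cycleType = {2, 2} →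
      ∀ τ π : Equiv.Perm (Fin 5),
        τ.IsCycle → τ.support.card = 5 →
        π.IsCycle → π.support.card = 5 →
        τ⁻¹ * π⁻¹ * τ * π ≠ ρ) ∧
    ¬ (∀ ρ : Equiv.Perm (Fin 5), ρ ∈ alternatingGroup (Fin 5) →
        ∃ τ π : Equiv.Perm (Fin 5),
          τ.IsCycle ∧ τ.support.card = 5 ∧
          π.IsCycle ∧ π.support.card = 5 ∧
          τ⁻¹ * π⁻¹ * τ * π = ρ) := by
  refine ⟨fun ρ hρ τ π hτ hτ_card hπ hπ_card h => ?_, fun hsurj => ?_⟩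
  · have hsq : ρ ^ 2 = 1 := by
      rw [← orderOf_dvd_iff_pow_eq_one, ← Equiv.Perm.lcm_cycleType, hρ]
      decide
    subst h
    rw [five_cycles_commutator_eq_one_of_sq_eq_one hτ hτ_card hπ hπ_card hsq,
      Equiv.Perm.cycleType_one] at hρ
    exact absurd hρ (by decide)
  · obtain ⟨τ, π, hτ, hτ_card, hπ, hπ_card, h⟩ :=
      hsurj (Equiv.swap 0 1 * Equiv.swap 2 3)
        (by rw [Equiv.Perm.mem_alternatingGroup]; decide)
    have hone := five_cycles_commutator_eq_one_of_sq_eq_one hτ hτ_card hπ hπ_card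
      (by rw [h]; decide)
    rw [h] at hone
    exact absurd hone (by decide)
end
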